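/- arXiv:2310.19154 — 7 statements merged into one kernel-verified Lean document; each statement's English description precedes it below -/
import Mathlib

section
/- Let L be a number field with ring of integers O. There exists a constant C > 0 (depending only on L) such that for all real x ≥ 3, the sum of 1/N(𝔭) over all nonzero prime ideals 𝔭 of O with absolute norm N(𝔭) ≤ x satisfies |∑_{N(𝔭) ≤ x} 1/N(𝔭) − log log x| ≤ C. -/
open scoped BigOperators

/-- Abel summation comparison: domination of partial sums is preserved by nonnegative antitone
weights. -/
theorem sum_mul_le_sum_mul_of_antitone {a b f : ℕ → ℝ} (hf : Antitone f) (hf0 : ∀ n, 0 ≤ f n)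
    (h : ∀ n, ∑ i ∈ Finset.range n, a i ≤ ∑ i ∈ Finset.range n, b i) (n : ℕ) :
    ∑ i ∈ Finset.range n, a i * f i ≤ ∑ i ∈ Finset.range n, b i * f i := by
  have key : ∀ n, (∑ i ∈ Finset.range n, (b i - a i)) * f n ≤
      ∑ i ∈ Finset.range n, (b i - a i) * f i := by
    intro n
    induction n with
    | zero => simp
    | succ n ih =>
      have h0 : 0 ≤ ∑ i ∈ Finset.range (n + 1), (b i - a i) := by
        rw [Finset.sum_sub_distrib]
        exact sub_nonneg.2 (h _)
      calc _ ≤ (∑ i ∈ Finset.range (n + 1), (b i - a i)) * f n :=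
            mul_le_mul_of_nonneg_left (hf n.le_succ) h0
        _ ≤ _ := by
            rw [Finset.sum_range_succ, Finset.sum_range_succ, add_mul]
            gcongr
  have h0 : 0 ≤ ∑ i ∈ Finset.range n, (b i - a i) := by
    rw [Finset.sum_sub_distrib]
    exact sub_nonneg.2 (h _)
  have := (mul_nonneg h0 (hf0 n)).trans (key n)
  simp only [sub_mul, Finset.sum_sub_distrib] at this
  exact sub_nonneg.1 this

theorem sum_range_add_one_rpow_le {δ : ℝ} (hδ : 0 < δ) (n : ℕ) :
    ∑ i ∈ Finset.range n, (((i + 1 : ℕ) : ℝ)) ^ (-(1 + δ)) ≤ 1 + 1 / δ := by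
  have key : ∀ n : ℕ, ∑ i ∈ Finset.range (n + 1), (((i + 1 : ℕ) : ℝ)) ^ (-(1 + δ)) ≤
      1 + 1 / δ - ((n + 1 : ℕ) : ℝ) ^ (-δ) / δ := by
    intro n
    induction n with
    | zero => simp
    | succ n ih =>
      rw [Finset.sum_range_succ]
      set k : ℝ := ((n + 1 : ℕ) : ℝ) with hk
      have hk0 : 0 < k := by positivity
      have hm : ((n + 1 + 1 : ℕ) : ℝ) = k + 1 := by push_cast [hk]; ring
      rw [hm]
      have h1 : 1 + δ / (k + 1) ≤ ((k + 1) / k) ^ δ := by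
        rw [Real.rpow_def_of_pos (by positivity)]
        have := Real.one_sub_inv_le_log_of_pos (x := (k + 1) / k) (by positivity)
        have e : 1 - ((k + 1) / k)⁻¹ = 1 / (k + 1) := by field_simp; ring
        rw [e] at this
        have h2 := Real.add_one_le_exp (Real.log ((k + 1) / k) * δ)
        have h3 := mul_le_mul_of_nonneg_right this hδ.le
        have e2 : 1 / (k + 1) * δ = δ / (k + 1) := by ring
        linarith
      have h2 : (k + 1) ^ (-δ) * (1 + δ / (k + 1)) ≤ k ^ (-δ) := by
        calc _ ≤ (k + 1) ^ (-δ) * ((k + 1) / k) ^ δ := by gcongr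
          _ = k ^ (-δ) := by
            rw [Real.div_rpow (by positivity) hk0.le, Real.rpow_neg (by positivity),
              Real.rpow_neg hk0.le]
            field_simp
      have h3 : (k + 1) ^ (-(1 + δ)) = (k + 1) ^ (-δ) / (k + 1) := by
        rw [neg_add_rev, ← sub_eq_add_neg, Real.rpow_sub_one (by positivity)]
      rw [h3]
      have h4 : (k + 1) ^ (-δ) / δ + (k + 1) ^ (-δ) / (k + 1) ≤ k ^ (-δ) / δ := by
        rw [le_div_iff₀ hδ]
        calc _ = (k + 1) ^ (-δ) * (1 + δ / (k + 1)) := by field_simp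
          _ ≤ _ := h2
      linarith
  cases n with
  | zero => simp; positivity
  | succ n => exact (key n).trans (sub_le_self _ (by positivity))

theorem log_le_sum_range_inv {x : ℝ} (hx : 0 < x) :
    Real.log x ≤ ∑ i ∈ Finset.range ⌊x⌋₊, (((i + 1 : ℕ) : ℝ))⁻¹ := by
  have h := log_add_one_le_harmonic ⌊x⌋₊
  refine (Real.log_le_log hx ?_).trans (h.trans_eq ?_)
  · push_cast
    exact (Nat.lt_floor_add_one x).le
  · simp [harmonic]

namespace NumberField

open Filter Topology nonZeroDivisors

variable (L : Type*) [Field L] [NumberField L]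

/-- The nonzero ideals of `𝓞 L` of absolute norm at most `n`. -/
noncomputable def idealsNormLE (n : ℕ) : Finset (Ideal (𝓞 L)) :=
  ((Ideal.finite_setOfPred_absNorm_le (S := 𝓞 L) n).subset
    (fun _ h ↦ h.2 : {I : Ideal (𝓞 L) | I ≠ ⊥ ∧ Ideal.absNorm I ≤ n} ⊆ _)).toFinset

open scoped Classical in
/-- The nonzero prime ideals of `𝓞 L` of absolute norm at most `n`. -/
noncomputable def primesNormLE (n : ℕ) : Finset (Ideal (𝓞 L)) :=
  (idealsNormLE L n).filter Ideal.IsPrime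

variable {L}

@[simp]
theorem mem_idealsNormLE {n : ℕ} {I : Ideal (𝓞 L)} :
    I ∈ idealsNormLE L n ↔ I ≠ ⊥ ∧ Ideal.absNorm I ≤ n := by
  simp [idealsNormLE]

@[simp]
theorem mem_primesNormLE {n : ℕ} {I : Ideal (𝓞 L)} :
    I ∈ primesNormLE L n ↔ (I ≠ ⊥ ∧ Ideal.absNorm I ≤ n) ∧ I.IsPrime := by
  simp [primesNormLE]

theorem absNorm_pos_of_ne_bot {I : Ideal (𝓞 L)} (hI : I ≠ ⊥) : 0 < Ideal.absNorm I :=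
  Nat.pos_of_ne_zero (Ideal.absNorm_eq_zero_iff.not.2 hI)

variable (L) in
@[simp]
theorem idealsNormLE_zero : idealsNormLE L 0 = ∅ := by
  ext I
  simp only [mem_idealsNormLE, Nat.le_zero, Ideal.absNorm_eq_zero_iff, Finset.notMem_empty,
    iff_false, not_and]
  exact id

variable (L) in
/-- The number of nonzero ideals of norm at most `n` has exact order `n`. -/
theorem exists_mul_le_card_idealsNormLE_le :
    ∃ c C : ℝ, 0 < c ∧ 0 < C ∧ ∀ n : ℕ,
      c * n ≤ (idealsNormLE L n).card ∧ ((idealsNormLE L n).card : ℝ) ≤ C * n := by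
  set u : ℕ → ℝ := fun n ↦ ((idealsNormLE L (n + 1)).card : ℝ) / ((n + 1 : ℕ) : ℝ) with hu
  have hlim : Tendsto u atTop (𝓝 (dedekindZeta_residue L)) := by
    refine (((Ideal.tendsto_norm_le_div_atTop₀ L).comp tendsto_natCast_atTop_atTop).comp
      (tendsto_add_atTop_nat 1)).congr fun n ↦ ?_
    simp only [Function.comp_apply, hu, Nat.cast_le]
    congr 2
    rw [← Fintype.card_coe, ← Nat.card_eq_fintype_card]
    refine Nat.card_congr ((Equiv.subtypeSubtypeEquivSubtypeInter (· ∈ (Ideal (𝓞 L))⁰)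
      (fun I ↦ Ideal.absNorm I ≤ n + 1)).trans (Equiv.subtypeEquivRight fun I ↦ ?_))
    simp [mem_nonZeroDivisors_iff_ne_zero]
  have hpos : ∀ n, 0 < u n := fun n ↦ by
    have : (⊤ : Ideal (𝓞 L)) ∈ idealsNormLE L (n + 1) := by simp
    have := Finset.card_pos.2 ⟨_, this⟩
    positivity
  obtain ⟨C, hC⟩ := hlim.bddAbove_range
  obtain ⟨B, hB⟩ := (hlim.inv₀ (dedekindZeta_residue_ne_zero L)).bddAbove_range
  have hC' : ∀ n, u n ≤ C := fun n ↦ hC ⟨n, rfl⟩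
  have hB' : ∀ n, (u n)⁻¹ ≤ B := fun n ↦ hB ⟨n, rfl⟩
  have hB0 : 0 < B := (inv_pos.2 (hpos 0)).trans_le (hB' 0)
  refine ⟨B⁻¹, C, inv_pos.2 hB0, (hpos 0).trans_le (hC' 0), fun n ↦ ?_⟩
  cases n with
  | zero => simp
  | succ n =>
    have hn : (0 : ℝ) < ((n + 1 : ℕ) : ℝ) := by positivity
    refine ⟨?_, (div_le_iff₀ hn).1 (hC' n)⟩
    exact (le_div_iff₀ hn).1 (inv_le_of_inv_le₀ (hpos n) (hB' n))

theorem sum_idealsNormLE (f : ℕ → ℝ) (n : ℕ) :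
    ∑ I ∈ idealsNormLE L n, f (Ideal.absNorm I) =
      ∑ i ∈ Finset.range n, (((idealsNormLE L (i + 1)).card : ℝ) - (idealsNormLE L i).card) *
        f (i + 1) := by
  classical
  induction n with
  | zero => simp
  | succ n ih =>
    have hsub : idealsNormLE L n ⊆ idealsNormLE L (n + 1) := fun I ↦ by
      simp only [mem_idealsNormLE]; exact fun h ↦ ⟨h.1, by omega⟩
    rw [Finset.sum_range_succ, ← ih, ← Finset.sum_sdiff hsub, add_comm]
    congr 1
    rw [← Nat.cast_sub (Finset.card_le_card hsub), ← Finset.card_sdiff_of_subset hsub,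
      ← nsmul_eq_mul, ← Finset.sum_const]
    refine Finset.sum_congr rfl fun I hI ↦ ?_
    simp only [Finset.mem_sdiff, mem_idealsNormLE, not_and, not_le] at hI
    rw [show Ideal.absNorm I = n + 1 from le_antisymm hI.1.2 (hI.2 hI.1.1)]

theorem sum_idealsNormLE_le {C : ℝ} (hC : ∀ n : ℕ, ((idealsNormLE L n).card : ℝ) ≤ C * n)
    {f : ℕ → ℝ} (hf : Antitone fun n ↦ f (n + 1)) (hf0 : ∀ n, 0 ≤ f (n + 1)) (n : ℕ) :
    ∑ I ∈ idealsNormLE L n, f (Ideal.absNorm I) ≤ C * ∑ i ∈ Finset.range n, f (i + 1) := by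
  rw [sum_idealsNormLE, Finset.mul_sum]
  refine sum_mul_le_sum_mul_of_antitone (b := fun _ ↦ C) hf hf0 (fun m ↦ ?_) n
  rw [Finset.sum_range_sub (fun i ↦ ((idealsNormLE L i).card : ℝ))]
  have := hC m
  simp only [Finset.sum_const, Finset.card_range, nsmul_eq_mul]
  have : (0 : ℝ) ≤ (idealsNormLE L 0).card := by positivity
  linarith

theorem le_sum_idealsNormLE {c : ℝ} (hc : ∀ n : ℕ, c * n ≤ (idealsNormLE L n).card)
    {f : ℕ → ℝ} (hf : Antitone fun n ↦ f (n + 1)) (hf0 : ∀ n, 0 ≤ f (n + 1)) (n : ℕ) :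
    c * ∑ i ∈ Finset.range n, f (i + 1) ≤ ∑ I ∈ idealsNormLE L n, f (Ideal.absNorm I) := by
  rw [sum_idealsNormLE, Finset.mul_sum]
  refine sum_mul_le_sum_mul_of_antitone (a := fun _ ↦ c) hf hf0 (fun m ↦ ?_) n
  rw [Finset.sum_range_sub (fun i ↦ ((idealsNormLE L i).card : ℝ))]
  have := hc m
  simp only [Finset.sum_const, Finset.card_range, nsmul_eq_mul, idealsNormLE_zero, Finset.card_empty]
  push_cast
  linarith

theorem sum_log_absNorm_dvd_le {I : Ideal (𝓞 L)} (hI : I ≠ ⊥) {s : Finset (Ideal (𝓞 L))}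
    (hs : ∀ p ∈ s, Prime p) (hd : ∀ p ∈ s, p ∣ I) :
    ∑ p ∈ s, Real.log (Ideal.absNorm p) ≤ Real.log (Ideal.absNorm I) := by
  have hdvd : ∏ p ∈ s, p ∣ I := Finset.prod_primes_dvd I hs hd
  rw [← Real.log_prod fun p hp ↦ Nat.cast_ne_zero.2 (absNorm_pos_of_ne_bot (hs p hp).ne_zero).ne',
    ← Nat.cast_prod, ← map_prod]
  refine Real.log_le_log ?_ ?_
  · exact_mod_cast absNorm_pos_of_ne_bot (Finset.prod_ne_zero_iff.2 fun p hp ↦ (hs p hp).ne_zero)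
  · exact_mod_cast Nat.le_of_dvd (absNorm_pos_of_ne_bot hI) (map_dvd Ideal.absNorm hdvd)

theorem prime_of_mem_primesNormLE {n : ℕ} {p : Ideal (𝓞 L)} (hp : p ∈ primesNormLE L n) :
    Prime p := by
  rw [mem_primesNormLE] at hp
  exact Ideal.prime_of_isPrime hp.1.1 hp.2

theorem card_idealsNormLE_div_le {n : ℕ} {p : Ideal (𝓞 L)} (hp : p ≠ ⊥)
    [DecidablePred (p ∣ · : Ideal (𝓞 L) → Prop)] :
    (idealsNormLE L (n / Ideal.absNorm p)).card ≤
      ((idealsNormLE L n).filter (p ∣ ·)).card := by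
  refine Finset.card_le_card_of_injOn (p * ·) (fun J hJ ↦ ?_)
    fun J _ J' _ h ↦ mul_left_cancel₀ hp h
  simp only [Finset.mem_coe, mem_idealsNormLE, Finset.mem_filter, map_mul] at hJ ⊢
  refine ⟨⟨mul_ne_zero hp hJ.1, ?_⟩, dvd_mul_right _ _⟩
  rw [mul_comm]
  exact (Nat.le_div_iff_mul_le (absNorm_pos_of_ne_bot hp)).1 hJ.2

/-- The upper bound in Mertens' first theorem for number fields. -/
theorem sum_log_absNorm_div_le {c C : ℝ} (hc0 : 0 < c)
    (hc : ∀ n : ℕ, c * n ≤ (idealsNormLE L n).card)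
    (hC : ∀ n : ℕ, ((idealsNormLE L n).card : ℝ) ≤ C * n) {n : ℕ} (hn : 0 < n) :
    ∑ p ∈ primesNormLE L n, Real.log (Ideal.absNorm p) / Ideal.absNorm p ≤
      2 * C / c * Real.log n := by
  classical
  have hn' : (0 : ℝ) < n := by exact_mod_cast hn
  have upper : ∑ I ∈ idealsNormLE L n, Real.log (Ideal.absNorm I) ≤ C * n * Real.log n := by
    calc _ ≤ ∑ I ∈ idealsNormLE L n, Real.log n := by
          refine Finset.sum_le_sum fun I hI ↦ ?_
          rw [mem_idealsNormLE] at hI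
          exact Real.log_le_log (by exact_mod_cast absNorm_pos_of_ne_bot hI.1)
            (by exact_mod_cast hI.2)
      _ = (idealsNormLE L n).card * Real.log n := by simp
      _ ≤ _ := mul_le_mul_of_nonneg_right (hC n) (Real.log_natCast_nonneg n)
  have lower : ∑ p ∈ primesNormLE L n,
      c / 2 * n * (Real.log (Ideal.absNorm p) / Ideal.absNorm p) ≤
      ∑ I ∈ idealsNormLE L n, Real.log (Ideal.absNorm I) := by
    calc _ ≤ ∑ p ∈ primesNormLE L n,
          ∑ I ∈ (idealsNormLE L n).filter (p ∣ ·), Real.log (Ideal.absNorm p) := by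
          refine Finset.sum_le_sum fun p hp ↦ ?_
          rw [mem_primesNormLE] at hp
          have hq := absNorm_pos_of_ne_bot hp.1.1
          rw [Finset.sum_const, nsmul_eq_mul]
          have h1 := card_idealsNormLE_div_le (n := n) hp.1.1
          have h2 := hc (n / Ideal.absNorm p)
          have h3 : n ≤ 2 * (n / Ideal.absNorm p) * Ideal.absNorm p := by
            have h4 := Nat.lt_div_mul_add (a := n) hq
            have h5 : 1 ≤ n / Ideal.absNorm p := (Nat.one_le_div_iff hq).2 hp.1.2
            nlinarith
          have hq' : (0 : ℝ) < Ideal.absNorm p := by exact_mod_cast hq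
          have h6 : (n : ℝ) / Ideal.absNorm p ≤ 2 * ((n / Ideal.absNorm p : ℕ) : ℝ) := by
            rw [div_le_iff₀ hq']
            exact_mod_cast h3
          have h7 : c / 2 * (n / Ideal.absNorm p) ≤
              (((idealsNormLE L n).filter (p ∣ ·)).card : ℝ) := by
            have : ((idealsNormLE L (n / Ideal.absNorm p)).card : ℝ) ≤
              (((idealsNormLE L n).filter (p ∣ ·)).card : ℝ) := by exact_mod_cast h1
            nlinarith
          calc _ = c / 2 * (n / Ideal.absNorm p) * Real.log (Ideal.absNorm p) := by ring
            _ ≤ _ := mul_le_mul_of_nonneg_right h7 (Real.log_natCast_nonneg _)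
      _ = ∑ I ∈ idealsNormLE L n,
          ∑ p ∈ (primesNormLE L n).filter (· ∣ I), Real.log (Ideal.absNorm p) := by
          simp_rw [Finset.sum_filter]
          exact Finset.sum_comm
      _ ≤ _ := by
          refine Finset.sum_le_sum fun I hI ↦ ?_
          rw [mem_idealsNormLE] at hI
          refine sum_log_absNorm_dvd_le hI.1 (fun p hp ↦ ?_) fun p hp ↦ (Finset.mem_filter.1 hp).2
          exact prime_of_mem_primesNormLE (Finset.mem_filter.1 hp).1
  rw [← Finset.mul_sum] at lower
  have h := lower.trans upper
  refine le_of_mul_le_mul_left (h.trans_eq ?_) (by positivity : 0 < c / 2 * n)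
  field_simp

theorem two_le_absNorm {p : Ideal (𝓞 L)} (hp : Prime p) : 2 ≤ Ideal.absNorm p := by
  have h0 := absNorm_pos_of_ne_bot hp.ne_zero
  have h1 : Ideal.absNorm p ≠ 1 := fun h ↦
    hp.not_isUnit (Ideal.isUnit_iff.2 (Ideal.absNorm_eq_one_iff.1 h))
  omega

/-- The partial sums of `∑ 1 / N(I)` are bounded by the corresponding partial Euler products. -/
theorem sum_inv_absNorm_le_prod (n : ℕ) :
    ∑ I ∈ idealsNormLE L n, (Ideal.absNorm I : ℝ)⁻¹ ≤
      ∏ p ∈ primesNormLE L n, (1 - (Ideal.absNorm p : ℝ)⁻¹)⁻¹ := by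
  classical
  open UniqueFactorizationMonoid in
  set P := primesNormLE L n
  set T := idealsNormLE L n
  let e : Ideal (𝓞 L) → Ideal (𝓞 L) → ℕ := fun I p ↦ (normalizedFactors I).count p
  have hfac : ∀ I ∈ T, ∏ p ∈ P, p ^ e I p = I := fun I hI ↦ by
    rw [mem_idealsNormLE] at hI
    rw [← Finset.prod_multiset_count_of_subset]
    · exact Ideal.prod_normalizedFactors_eq_self hI.1
    · intro p hp
      rw [Multiset.mem_toFinset] at hp
      have hprime := prime_of_normalized_factor p hp
      have hdvd := dvd_of_mem_normalizedFactors hp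
      rw [mem_primesNormLE]
      exact ⟨⟨hprime.ne_zero, (Nat.le_of_dvd (absNorm_pos_of_ne_bot hI.1)
        (map_dvd Ideal.absNorm hdvd)).trans hI.2⟩, Ideal.isPrime_of_prime hprime⟩
  obtain ⟨m, hm⟩ : ∃ m, ∀ I ∈ T, ∀ p ∈ P, e I p < m := by
    refine ⟨(T.sup fun I ↦ P.sup (e I)) + 1, fun I hI p hp ↦ Nat.lt_succ_of_le ?_⟩
    exact (Finset.le_sup (f := e I) hp).trans (Finset.le_sup (f := fun I ↦ P.sup (e I)) hI)
  calc _ = ∑ I ∈ T, ∏ p ∈ P.attach, ((Ideal.absNorm p.1 : ℝ)⁻¹) ^ e I p.1 := by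
        refine Finset.sum_congr rfl fun I hI ↦ ?_
        rw [Finset.prod_attach P fun p ↦ ((Ideal.absNorm p : ℝ)⁻¹) ^ e I p]
        conv_lhs => rw [← hfac I hI]
        simp [map_prod]
    _ ≤ ∑ g ∈ P.pi fun _ ↦ Finset.range m,
          ∏ p ∈ P.attach, ((Ideal.absNorm p.1 : ℝ)⁻¹) ^ g p.1 p.2 := by
        have hinj : Set.InjOn (fun I ↦ fun p (_ : p ∈ P) ↦ e I p) T := fun I hI J hJ h ↦ by
          rw [← hfac I hI, ← hfac J hJ]
          refine Finset.prod_congr rfl fun p hp ↦ ?_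
          exact congrArg (p ^ ·) (congr_fun₂ h p hp)
        rw [← Finset.sum_image (f := fun g : (p : Ideal (𝓞 L)) → p ∈ P → ℕ ↦
          ∏ p ∈ P.attach, ((Ideal.absNorm p.1 : ℝ)⁻¹) ^ g p.1 p.2) hinj]
        refine Finset.sum_le_sum_of_subset_of_nonneg (fun g hg ↦ ?_)
          fun _ _ _ ↦ Finset.prod_nonneg fun _ _ ↦ by positivity
        obtain ⟨I, hI, rfl⟩ := Finset.mem_image.1 hg
        simpa using fun p hp ↦ hm I hI p hp
    _ = ∏ p ∈ P, ∑ k ∈ Finset.range m, ((Ideal.absNorm p : ℝ)⁻¹) ^ k :=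
        (Finset.prod_sum P (fun _ ↦ Finset.range m)
          fun p k ↦ ((Ideal.absNorm p : ℝ)⁻¹) ^ k).symm
    _ ≤ _ := by
        refine Finset.prod_le_prod (fun _ _ ↦ by positivity) fun p hp ↦ ?_
        have h2 : (2 : ℝ) ≤ Ideal.absNorm p := by
          exact_mod_cast two_le_absNorm (prime_of_mem_primesNormLE hp)
        have h0 : (0 : ℝ) ≤ (Ideal.absNorm p : ℝ)⁻¹ := by positivity
        have h1 : (Ideal.absNorm p : ℝ)⁻¹ < 1 := inv_lt_one_of_one_lt₀ (by linarith)
        rw [← tsum_geometric_of_lt_one h0 h1]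
        exact (summable_geometric_of_lt_one h0 h1).sum_le_tsum _ fun _ _ ↦ by positivity

/-- Finite products `∏ (1 + N(p)^(-s))` are bounded by sums of `N(I)^(-s)`. -/
theorem exists_prod_one_add_le_sum (n : ℕ) (s : ℝ) :
    ∃ m : ℕ, ∏ p ∈ primesNormLE L n, (1 + (Ideal.absNorm p : ℝ) ^ s) ≤
      ∑ I ∈ idealsNormLE L m, (Ideal.absNorm I : ℝ) ^ s := by
  classical
  set P := primesNormLE L n
  have hP : ∀ p ∈ P, Prime p := fun p hp ↦ prime_of_mem_primesNormLE hp
  refine ⟨Ideal.absNorm (∏ p ∈ P, p), ?_⟩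
  rw [Finset.prod_one_add]
  have hinj : Set.InjOn (fun U : Finset (Ideal (𝓞 L)) ↦ ∏ p ∈ U, p) P.powerset := by
    have key : ∀ U ∈ P.powerset, ∀ p ∈ P, p ∣ ∏ q ∈ U, q ↔ p ∈ U := by
      intro U hU p hp
      refine ⟨fun h ↦ ?_, fun h ↦ Finset.dvd_prod_of_mem _ h⟩
      obtain ⟨q, hq, hpq⟩ := (hP p hp).exists_mem_finset_dvd h
      have := (hP p hp).associated_of_dvd (hP q (Finset.mem_powerset.1 hU hq)) hpq
      rwa [associated_iff_eq.1 this]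
    intro U hU V hV (h : ∏ p ∈ U, p = ∏ p ∈ V, p)
    ext p
    constructor <;> intro hp
    · have hpP := Finset.mem_powerset.1 hU hp
      rw [← key V hV p hpP, ← h]
      exact (key U hU p hpP).2 hp
    · have hpP := Finset.mem_powerset.1 hV hp
      rw [← key U hU p hpP, h]
      exact (key V hV p hpP).2 hp
  calc _ = ∑ U ∈ P.powerset, (Ideal.absNorm (∏ p ∈ U, p) : ℝ) ^ s := by
        refine Finset.sum_congr rfl fun U _ ↦ ?_
        rw [map_prod, Nat.cast_prod, Real.finsetProd_rpow _ _ fun _ _ ↦ by positivity]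
    _ = ∑ I ∈ P.powerset.image fun U ↦ ∏ p ∈ U, p, (Ideal.absNorm I : ℝ) ^ s :=
        (Finset.sum_image (f := fun I ↦ (Ideal.absNorm I : ℝ) ^ s) hinj).symm
    _ ≤ _ := by
        refine Finset.sum_le_sum_of_subset_of_nonneg (fun I hI ↦ ?_) fun _ _ _ ↦ by positivity
        obtain ⟨U, hU, rfl⟩ := Finset.mem_image.1 hI
        rw [Finset.mem_powerset] at hU
        rw [mem_idealsNormLE]
        refine ⟨Finset.prod_ne_zero_iff.2 fun p hp ↦ (hP p (hU hp)).ne_zero, ?_⟩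
        refine Nat.le_of_dvd (absNorm_pos_of_ne_bot ?_)
          (map_dvd Ideal.absNorm (Finset.prod_dvd_prod_of_subset _ _ _ hU))
        exact Finset.prod_ne_zero_iff.2 fun p hp ↦ (hP p hp).ne_zero

theorem sum_rpow_absNorm_le {C : ℝ} (hC0 : 0 < C)
    (hC : ∀ n : ℕ, ((idealsNormLE L n).card : ℝ) ≤ C * n) {δ : ℝ} (hδ : 0 < δ) (n : ℕ) :
    ∑ I ∈ idealsNormLE L n, (Ideal.absNorm I : ℝ) ^ (-(1 + δ)) ≤ C * (1 + 1 / δ) := by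
  refine (sum_idealsNormLE_le hC (f := fun k ↦ (k : ℝ) ^ (-(1 + δ))) (fun i j hij ↦ ?_)
    (fun _ ↦ by positivity) n).trans
      (mul_le_mul_of_nonneg_left (sum_range_add_one_rpow_le hδ n) hC0.le)
  refine Real.rpow_le_rpow_of_nonpos (by positivity) ?_ (by linarith)
  exact_mod_cast Nat.succ_le_succ hij

theorem sum_primesNormLE_inv_sq_le {C : ℝ} (hC0 : 0 < C)
    (hC : ∀ n : ℕ, ((idealsNormLE L n).card : ℝ) ≤ C * n) (n : ℕ) :
    ∑ p ∈ primesNormLE L n, ((Ideal.absNorm p : ℝ)⁻¹) ^ 2 ≤ 2 * C := by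
  have h := sum_rpow_absNorm_le hC0 hC one_pos n
  calc _ ≤ ∑ I ∈ idealsNormLE L n, ((Ideal.absNorm I : ℝ)⁻¹) ^ 2 :=
        Finset.sum_le_sum_of_subset_of_nonneg (fun p hp ↦
          mem_idealsNormLE.2 (mem_primesNormLE.1 hp).1) fun _ _ _ ↦ by positivity
    _ = ∑ I ∈ idealsNormLE L n, (Ideal.absNorm I : ℝ) ^ (-(1 + 1 : ℝ)) := by
        refine Finset.sum_congr rfl fun I _ ↦ ?_
        rw [Real.rpow_neg (by positivity), inv_pow]
        norm_num
    _ ≤ _ := h.trans_eq (by ring)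

theorem log_log_le_sum_inv_absNorm {c C : ℝ} (hc0 : 0 < c) (hC0 : 0 < C)
    (hc : ∀ n : ℕ, c * n ≤ (idealsNormLE L n).card)
    (hC : ∀ n : ℕ, ((idealsNormLE L n).card : ℝ) ≤ C * n) {x : ℝ} (hx : 1 < x) :
    Real.log (Real.log x) ≤
      ∑ p ∈ primesNormLE L ⌊x⌋₊, (Ideal.absNorm p : ℝ)⁻¹ + (4 * C - Real.log c) := by
  set P := primesNormLE L ⌊x⌋₊
  have hlog : 0 < Real.log x := Real.log_pos hx
  have h1 : c * Real.log x ≤ ∑ I ∈ idealsNormLE L ⌊x⌋₊, (Ideal.absNorm I : ℝ)⁻¹ :=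
    (mul_le_mul_of_nonneg_left (log_le_sum_range_inv (by linarith)) hc0.le).trans
      (le_sum_idealsNormLE hc (f := fun k ↦ (k : ℝ)⁻¹) (fun i j hij ↦ by
        simp only; gcongr) (fun _ ↦ by positivity) _)
  have h2 : ∏ p ∈ P, (1 - (Ideal.absNorm p : ℝ)⁻¹)⁻¹ ≤
      Real.exp (∑ p ∈ P, ((Ideal.absNorm p : ℝ)⁻¹ + 2 * ((Ideal.absNorm p : ℝ)⁻¹) ^ 2)) := by
    have ht : ∀ p ∈ P, (Ideal.absNorm p : ℝ)⁻¹ ≤ 1 / 2 := fun p hp ↦ by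
      have : (2 : ℝ) ≤ Ideal.absNorm p := by
        exact_mod_cast two_le_absNorm (prime_of_mem_primesNormLE hp)
      rw [one_div]
      gcongr
    rw [Real.exp_sum]
    refine Finset.prod_le_prod (fun p hp ↦ inv_nonneg.2 (by linarith [ht p hp])) fun p hp ↦ ?_
    have ht := ht p hp
    have ht0 : 0 ≤ (Ideal.absNorm p : ℝ)⁻¹ := by positivity
    generalize (Ideal.absNorm p : ℝ)⁻¹ = t at ht ht0 ⊢
    refine le_trans ?_ (Real.add_one_le_exp _)
    rw [inv_le_iff_one_le_mul₀ (by linarith)]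
    nlinarith [mul_nonneg (mul_nonneg ht0 ht0) (by linarith : 0 ≤ 1 - 2 * t)]
  have h3 := Real.log_le_log (by positivity) (h1.trans ((sum_inv_absNorm_le_prod _).trans h2))
  rw [Real.log_exp, Real.log_mul hc0.ne' hlog.ne', Finset.sum_add_distrib, ← Finset.mul_sum] at h3
  have h4 := sum_primesNormLE_inv_sq_le hC0 hC ⌊x⌋₊
  linarith

theorem sum_rpow_absNorm_primesNormLE_le {C : ℝ} (hC0 : 0 < C)
    (hC : ∀ n : ℕ, ((idealsNormLE L n).card : ℝ) ≤ C * n) {δ : ℝ} (hδ : 0 < δ) (n : ℕ) :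
    ∑ p ∈ primesNormLE L n, (Ideal.absNorm p : ℝ) ^ (-(1 + δ)) ≤
      Real.log (C * (1 + 1 / δ)) + 2 * C := by
  set P := primesNormLE L n
  obtain ⟨m, hm⟩ := exists_prod_one_add_le_sum (L := L) n (-(1 + δ))
  have h1 := hm.trans (sum_rpow_absNorm_le hC0 hC hδ m)
  have h2 : Real.exp (∑ p ∈ P, ((Ideal.absNorm p : ℝ) ^ (-(1 + δ)) -
      ((Ideal.absNorm p : ℝ) ^ (-(1 + δ))) ^ 2)) ≤
      ∏ p ∈ P, (1 + (Ideal.absNorm p : ℝ) ^ (-(1 + δ))) := by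
    rw [Real.exp_sum]
    refine Finset.prod_le_prod (fun _ _ ↦ by positivity) fun p _ ↦ ?_
    have ht0 : 0 ≤ (Ideal.absNorm p : ℝ) ^ (-(1 + δ)) := by positivity
    generalize (Ideal.absNorm p : ℝ) ^ (-(1 + δ)) = t at ht0 ⊢
    rw [← Real.le_log_iff_exp_le (by linarith)]
    refine le_trans ?_ (Real.one_sub_inv_le_log_of_pos (by linarith))
    have : 1 - (1 + t)⁻¹ = t / (1 + t) := by field_simp; ring
    rw [this, le_div_iff₀ (by linarith)]
    nlinarith [pow_nonneg ht0 3]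
  have h3 := (Real.le_log_iff_exp_le (by positivity)).2 (h2.trans h1)
  rw [Finset.sum_sub_distrib] at h3
  have h4 : ∑ p ∈ P, ((Ideal.absNorm p : ℝ) ^ (-(1 + δ))) ^ 2 ≤ 2 * C := by
    refine le_trans (Finset.sum_le_sum fun p hp ↦ ?_) (sum_primesNormLE_inv_sq_le hC0 hC n)
    have : (1 : ℝ) ≤ Ideal.absNorm p := by
      exact_mod_cast (two_le_absNorm (prime_of_mem_primesNormLE hp)).trans' one_le_two
    gcongr
    rw [← Real.rpow_neg_one]
    exact Real.rpow_le_rpow_of_exponent_le this (by linarith)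
  linarith

theorem sum_inv_absNorm_le_log_log {c C : ℝ} (hc0 : 0 < c) (hC0 : 0 < C)
    (hc : ∀ n : ℕ, c * n ≤ (idealsNormLE L n).card)
    (hC : ∀ n : ℕ, ((idealsNormLE L n).card : ℝ) ≤ C * n) {x : ℝ} (hx : 3 ≤ x) :
    ∑ p ∈ primesNormLE L ⌊x⌋₊, (Ideal.absNorm p : ℝ)⁻¹ ≤
      Real.log (Real.log x) + (Real.log (2 * C) + 2 * C + 2 * C / c) := by
  set P := primesNormLE L ⌊x⌋₊
  have hlog : 1 ≤ Real.log x := by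
    rw [Real.le_log_iff_exp_le (by linarith)]
    linarith [Real.exp_one_lt_three]
  set δ : ℝ := (Real.log x)⁻¹ with hδ
  have hδ0 : 0 < δ := by positivity
  have h1 := sum_rpow_absNorm_primesNormLE_le hC0 hC hδ0 ⌊x⌋₊
  have h2 : ∑ p ∈ P, Real.log (Ideal.absNorm p) / Ideal.absNorm p ≤ 2 * C / c * Real.log x := by
    have hn : 0 < ⌊x⌋₊ := Nat.floor_pos.2 (by linarith)
    refine (sum_log_absNorm_div_le hc0 hc hC hn).trans ?_
    gcongr
    exact Nat.floor_le (by linarith)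
  have h3 : ∑ p ∈ P, (Ideal.absNorm p : ℝ)⁻¹ ≤ ∑ p ∈ P, (Ideal.absNorm p : ℝ) ^ (-(1 + δ)) +
      δ * ∑ p ∈ P, Real.log (Ideal.absNorm p) / Ideal.absNorm p := by
    rw [Finset.mul_sum, ← Finset.sum_add_distrib]
    refine Finset.sum_le_sum fun p hp ↦ ?_
    have hq : (0 : ℝ) < Ideal.absNorm p := by
      exact_mod_cast absNorm_pos_of_ne_bot (prime_of_mem_primesNormLE hp).ne_zero
    generalize (Ideal.absNorm p : ℝ) = q at hq ⊢
    have h4 : 1 - δ * Real.log q ≤ q ^ (-δ) := by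
      rw [Real.rpow_def_of_pos hq]
      linarith [Real.add_one_le_exp (Real.log q * -δ)]
    have h5 : q ^ (-(1 + δ)) = q⁻¹ * q ^ (-δ) := by
      rw [neg_add, Real.rpow_add hq, Real.rpow_neg_one]
    have h6 := mul_le_mul_of_nonneg_left h4 (inv_pos.2 hq).le
    rw [h5]
    have : δ * (Real.log q / q) = q⁻¹ * (δ * Real.log q) := by ring
    linarith
  have h4 : δ * ∑ p ∈ P, Real.log (Ideal.absNorm p) / Ideal.absNorm p ≤ 2 * C / c := by
    refine (mul_le_mul_of_nonneg_left h2 hδ0.le).trans_eq ?_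
    rw [hδ]
    field_simp
  have h5 : Real.log (C * (1 + 1 / δ)) ≤ Real.log (2 * C) + Real.log (Real.log x) := by
    rw [← Real.log_mul (by positivity) (by positivity)]
    refine Real.log_le_log (by positivity) ?_
    rw [hδ, one_div, inv_inv]
    nlinarith
  linarith

end NumberField

/-- There exists a constant `C > 0`, depending only on the number field `L`, such that
for all real `x ≥ 3`, the sum of `1/N(𝔭)` over nonzero prime ideals `𝔭` of the ring of
integers of `L` with absolute norm `N(𝔭) ≤ x` is within `C` of `log log x`. -/
theorem sum_one_div_norm_prime_le_eq_log_log_add_bounded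
    (L : Type*) [Field L] [NumberField L] :
    ∃ C : ℝ, 0 < C ∧ ∀ x : ℝ, 3 ≤ x →
      |(∑ᶠ p ∈ {p : Ideal (NumberField.RingOfIntegers L) |
          p.IsPrime ∧ p ≠ ⊥ ∧ (Ideal.absNorm p : ℝ) ≤ x},
          (1 : ℝ) / (Ideal.absNorm p : ℝ)) - Real.log (Real.log x)| ≤ C := by
  obtain ⟨c, C, hc0, hC0, hcC⟩ := NumberField.exists_mul_le_card_idealsNormLE_le L
  have hc := fun n ↦ (hcC n).1
  have hC := fun n ↦ (hcC n).2
  set A := 4 * C - Real.log c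
  set B := Real.log (2 * C) + 2 * C + 2 * C / c
  refine ⟨|A| + |B| + 1, by positivity, fun x hx ↦ ?_⟩
  have hset : {p : Ideal (NumberField.RingOfIntegers L) |
      p.IsPrime ∧ p ≠ ⊥ ∧ (Ideal.absNorm p : ℝ) ≤ x} = NumberField.primesNormLE L ⌊x⌋₊ := by
    ext p
    simp only [Set.mem_ofPred_eq, Finset.mem_coe, NumberField.mem_primesNormLE,
      Nat.le_floor_iff (by linarith : 0 ≤ x)]
    tauto
  rw [hset, finsum_mem_coe_finset]
  simp only [one_div]
  have hlower := NumberField.log_log_le_sum_inv_absNorm hc0 hC0 hc hC (by linarith : 1 < x)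
  have hupper := NumberField.sum_inv_absNorm_le_log_log hc0 hC0 hc hC hx
  rw [abs_le]
  constructor <;> linarith [le_abs_self A, le_abs_self B, abs_nonneg A, abs_nonneg B]
end

section
/- For all non-negative integers m and n with m ≥ n, and all real x, U_m(x)·U_n(x) = ∑_{k=0}^{n} U_{m+n−2k}(x). -/
open Polynomial

/-- The product of `U_m`, for any integer `m`, and `U_n`, over any commutative ring. -/
theorem Polynomial.Chebyshev.U_mul_U_natCast (R : Type*) [CommRing R] (m : ℤ) (n : ℕ) :
    Chebyshev.U R m * Chebyshev.U R n =
      ∑ k ∈ Finset.range (n + 1), Chebyshev.U R (m + n - 2 * k) := by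
  induction n using Nat.twoStepInduction with
  | zero => simp
  | one =>
    simp only [Finset.sum_range_succ, Finset.sum_range_zero, Nat.cast_one, Nat.cast_zero,
      Chebyshev.U_one, mul_zero, sub_zero, mul_one, zero_add]
    rw [Chebyshev.U_add_one, show m + 1 - 2 = m - 1 by ring]
    ring
  | more n ih₀ ih₁ =>
    have recurrence (k : ℕ) :
        2 * X * Chebyshev.U R (m + (n + 1 : ℕ) - 2 * k) =
          Chebyshev.U R (m + (n + 2 : ℕ) - 2 * k) + Chebyshev.U R (m + n - 2 * k) := by
      have h := Chebyshev.U_add_two R (m + n - 2 * k)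
      rw [show m + n - 2 * k + 2 = m + (n + 2 : ℕ) - 2 * k by push_cast; ring,
        show m + n - 2 * k + 1 = m + (n + 1 : ℕ) - 2 * k by push_cast; ring] at h
      rw [h, sub_add_cancel]
    have last : m + (n + 2 : ℕ) - 2 * (n + 2 : ℕ) = m + n - 2 * (n + 1 : ℕ) := by
      push_cast; ring
    calc Chebyshev.U R m * Chebyshev.U R (n + 2 : ℕ)
        = 2 * X * (Chebyshev.U R m * Chebyshev.U R (n + 1 : ℕ)) -
            Chebyshev.U R m * Chebyshev.U R n := by
          push_cast
          rw [Chebyshev.U_add_two]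
          ring
      _ = ∑ k ∈ Finset.range (n + 2 + 1), Chebyshev.U R (m + (n + 2 : ℕ) - 2 * k) := by
          rw [ih₀, ih₁, Finset.mul_sum, Finset.sum_congr rfl fun k _ => recurrence k,
            Finset.sum_add_distrib, Finset.sum_range_succ _ (n + 2), last,
            Finset.sum_range_succ (fun k : ℕ => Chebyshev.U R (m + n - 2 * k)) (n + 1)]
          ring

/-- Product formula for Chebyshev polynomials of the second kind: for `m ≥ n`,
`U_m(x) · U_n(x) = ∑_{k=0}^n U_{m+n−2k}(x)`. -/
theorem chebyshevU_mul_chebyshevU (m n : ℕ) (h : n ≤ m) (x : ℝ) :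
    (Polynomial.Chebyshev.U ℝ m).eval x * (Polynomial.Chebyshev.U ℝ n).eval x =
      ∑ k ∈ Finset.range (n + 1),
        (Polynomial.Chebyshev.U ℝ ((m : ℤ) + n - 2 * k)).eval x := by
  rw [← eval_mul, Chebyshev.U_mul_U_natCast, eval_finsetSum]
end

section
/- Let q > 1 be a real number and m a non-negative integer. Then ∫_0^π U_m(cos θ) · [(q + 1)/((q^{1/2} + q^{−1/2})² − 4cos²θ)] · (2/π) sin²θ dθ equals q^{−m/2} if m is even and equals 0 if m is odd. -/
open Polynomial Real

/-- The integral of `U_n(cos θ)` against `μ_q`, written with sines. -/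
noncomputable def sineMoment (q : ℝ) (n : ℕ) : ℝ :=
  ∫ θ in (0:ℝ)..π, sin ((n + 1) * θ) *
    ((q + 1) / (q + q⁻¹ - 2 * cos (2 * θ)) * ((2 / π) * sin θ))

lemma two_lt_add_inv {q : ℝ} (hq : 1 < q) : 2 < q + q⁻¹ := by
  have h0 : 0 < q := by linarith
  have h : q + q⁻¹ - 2 = (q - 1) ^ 2 / q := by field_simp; ring
  have : 0 < (q - 1) ^ 2 / q := by
    have : 0 < q - 1 := by linarith
    positivity
  linarith

lemma add_inv_sub_two_mul_cos_pos {q : ℝ} (hq : 1 < q) (x : ℝ) :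
    0 < q + q⁻¹ - 2 * cos x := by
  linarith [two_lt_add_inv hq, cos_le_one x]

lemma continuous_sineMoment_weight {q : ℝ} (hq : 1 < q) :
    Continuous fun θ : ℝ ↦
      (q + 1) / (q + q⁻¹ - 2 * cos (2 * θ)) * ((2 / π) * sin θ) := by
  refine (Continuous.div (by fun_prop) (by fun_prop) fun θ ↦ ?_).mul (by fun_prop)
  exact (add_inv_sub_two_mul_cos_pos hq _).ne'

lemma intervalIntegrable_sineMoment {q : ℝ} (hq : 1 < q) (n : ℕ) :
    IntervalIntegrable (fun θ : ℝ ↦ sin ((n + 1) * θ) *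
      ((q + 1) / (q + q⁻¹ - 2 * cos (2 * θ)) * ((2 / π) * sin θ))) MeasureTheory.volume 0 π :=
  (Continuous.mul (by fun_prop) (continuous_sineMoment_weight hq)).intervalIntegrable _ _

lemma exists_abs_sineMoment_le {q : ℝ} (hq : 1 < q) : ∃ C, ∀ n, |sineMoment q n| ≤ C := by
  refine ⟨∫ θ in (0:ℝ)..π,
    |(q + 1) / (q + q⁻¹ - 2 * cos (2 * θ)) * ((2 / π) * sin θ)|, fun n ↦ ?_⟩
  refine (intervalIntegral.abs_integral_le_integral_abs pi_pos.le).trans ?_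
  refine intervalIntegral.integral_mono_on pi_pos.le (intervalIntegrable_sineMoment hq n).abs
    ((continuous_sineMoment_weight hq).abs.intervalIntegrable _ _) fun θ _ ↦ ?_
  rw [abs_mul]
  exact mul_le_of_le_one_left (abs_nonneg _) (abs_sin_le_one _)

lemma integral_cos_nat_mul {k : ℕ} (hk : k ≠ 0) : ∫ θ in (0:ℝ)..π, cos (k * θ) = 0 := by
  rw [intervalIntegral.integral_comp_mul_left (fun x ↦ cos x) (Nat.cast_ne_zero.mpr hk)]
  simp [sin_nat_mul_pi]

lemma integral_sin_nat_mul_sin {n : ℕ} (hn : n ≠ 0) :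
    ∫ θ in (0:ℝ)..π, sin ((n + 1) * θ) * sin θ = 0 := by
  have h : ∀ θ : ℝ, sin ((n + 1) * θ) * sin θ =
      (cos (n * θ) - cos ((n + 2 : ℕ) * θ)) / 2 := fun θ ↦ by
    have h1 : (n : ℝ) * θ = (n + 1) * θ - θ := by ring
    have h2 : ((n + 2 : ℕ) : ℝ) * θ = (n + 1) * θ + θ := by push_cast; ring
    rw [h1, h2, cos_sub, cos_add]
    ring
  simp_rw [h]
  rw [intervalIntegral.integral_div, intervalIntegral.integral_sub
    (Continuous.intervalIntegrable (by fun_prop) _ _)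
    (Continuous.intervalIntegrable (by fun_prop) _ _),
    integral_cos_nat_mul hn, integral_cos_nat_mul (by omega)]
  simp

/-- Multiplying by the denominator of the density turns moments into sine integrals. -/
lemma integral_combination_sineMoment {q : ℝ} (hq : 1 < q) (a b c : ℕ) (r s t : ℝ) (n : ℕ)
    (h : ∀ θ : ℝ, r * sin ((a + 1) * θ) + s * sin ((b + 1) * θ) + t * sin ((c + 1) * θ) =
      (q + q⁻¹ - 2 * cos (2 * θ)) * sin ((n + 1) * θ)) :
    r * sineMoment q a + s * sineMoment q b + t * sineMoment q c =
      (q + 1) * (2 / π) * ∫ θ in (0:ℝ)..π, sin ((n + 1) * θ) * sin θ := by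
  unfold sineMoment
  rw [← intervalIntegral.integral_const_mul, ← intervalIntegral.integral_const_mul,
    ← intervalIntegral.integral_const_mul, ← intervalIntegral.integral_const_mul,
    ← intervalIntegral.integral_add ((intervalIntegrable_sineMoment hq a).const_mul r)
      ((intervalIntegrable_sineMoment hq b).const_mul s),
    ← intervalIntegral.integral_add (((intervalIntegrable_sineMoment hq a).const_mul r).add
      ((intervalIntegrable_sineMoment hq b).const_mul s))
      ((intervalIntegrable_sineMoment hq c).const_mul t)]
  refine intervalIntegral.integral_congr fun θ _ ↦ ?_
  have hD := (add_inv_sub_two_mul_cos_pos hq (2 * θ)).ne'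
  have h' := h θ
  generalize q + q⁻¹ - 2 * cos (2 * θ) = D at hD h' ⊢
  calc _ = (r * sin ((a + 1) * θ) + s * sin ((b + 1) * θ) + t * sin ((c + 1) * θ)) *
        ((q + 1) / D * ((2 / π) * sin θ)) := by ring
    _ = _ := by rw [h']; field_simp

lemma sineMoment_add_four {q : ℝ} (hq : 1 < q) (n : ℕ) :
    sineMoment q (n + 4) = (q + q⁻¹) * sineMoment q (n + 2) - sineMoment q n := by
  have h := integral_combination_sineMoment hq (n + 2) (n + 4) n (q + q⁻¹) (-1) (-1) (n + 2)
    fun θ ↦ by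
      have h1 : ((n + 4 : ℕ) + 1 : ℝ) * θ = ((n + 2 : ℕ) + 1) * θ + 2 * θ := by push_cast; ring
      have h2 : ((n : ℝ) + 1) * θ = ((n + 2 : ℕ) + 1) * θ - 2 * θ := by push_cast; ring
      rw [h1, h2, sin_add, sin_sub]
      ring
  rw [integral_sin_nat_mul_sin (by omega)] at h
  linarith

lemma eq_zero_of_abs_le_of_add_two {q C : ℝ} (hq : 1 < q) {J : ℕ → ℝ}
    (hC : ∀ n, |J n| ≤ C) (hJ : ∀ n, J (n + 2) = q * J n) (n : ℕ) : J n = 0 := by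
  have hpow : ∀ k, J (n + 2 * k) = q ^ k * J n := fun k ↦ by
    induction k with
    | zero => simp
    | succ k ih => rw [show n + 2 * (k + 1) = n + 2 * k + 2 by ring, hJ, ih]; ring
  by_contra hne
  have hpos : 0 < |J n| := abs_pos.mpr hne
  obtain ⟨k, hk⟩ := pow_unbounded_of_one_lt (C / |J n|) hq
  have h := hC (n + 2 * k)
  rw [hpow, abs_mul, abs_of_pos (pow_pos (by linarith) k)] at h
  rw [div_lt_iff₀ hpos] at hk
  linarith

lemma sineMoment_add_two {q : ℝ} (hq : 1 < q) (n : ℕ) :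
    sineMoment q (n + 2) = q⁻¹ * sineMoment q n := by
  obtain ⟨C, hC⟩ := exists_abs_sineMoment_le hq
  have hq0 : q ≠ 0 := by linarith
  have h := eq_zero_of_abs_le_of_add_two (C := C + |q⁻¹| * C) hq
    (J := fun n ↦ sineMoment q (n + 2) - q⁻¹ * sineMoment q n)
    (fun n ↦ (abs_sub _ _).trans (add_le_add (hC _) (by
      rw [abs_mul]; exact mul_le_mul_of_nonneg_left (hC n) (abs_nonneg _))))
    (fun n ↦ by
      rw [sineMoment_add_four hq]
      field_simp
      ring) n
  exact sub_eq_zero.mp h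

lemma sineMoment_zero {q : ℝ} (hq : 1 < q) : sineMoment q 0 = 1 := by
  have h := integral_combination_sineMoment hq 0 2 0 (q + q⁻¹) (-1) 1 0 fun θ ↦ by
    have h1 : ((2 : ℕ) + 1 : ℝ) * θ = 2 * θ + θ := by push_cast; ring
    have h2 : ((0 : ℕ) + 1 : ℝ) * θ = 2 * θ - θ := by push_cast; ring
    have h3 : sin θ = sin (2 * θ) * cos θ - cos (2 * θ) * sin θ := by
      rw [← sin_sub]; ring_nf
    rw [h1, h2, sin_add, sin_sub]
    linear_combination -2 * cos (2 * θ) * h3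
  have hI : ∫ θ in (0:ℝ)..π, sin (((0 : ℕ) + 1) * θ) * sin θ = π / 2 := by
    simp [← pow_two, integral_sin_sq]
  rw [hI, sineMoment_add_two hq 0] at h
  have hpi := pi_ne_zero
  have h' : (q + 1) * sineMoment q 0 = (q + 1) * 1 := by
    have : (q + 1) * (2 / π) * (π / 2) = q + 1 := by field_simp
    linarith
  exact mul_left_cancel₀ (by linarith) h'

lemma sineMoment_one {q : ℝ} (hq : 1 < q) : sineMoment q 1 = 0 := by
  have h := integral_combination_sineMoment hq 1 3 1 (q + q⁻¹) (-1) 0 1 fun θ ↦ by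
    have h1 : ((3 : ℕ) + 1 : ℝ) * θ = 2 * (2 * θ) := by push_cast; ring
    have h2 : ((1 : ℕ) + 1 : ℝ) * θ = 2 * θ := by push_cast; ring
    rw [h1, h2, sin_two_mul (2 * θ)]
    ring
  rw [integral_sin_nat_mul_sin one_ne_zero, sineMoment_add_two hq 1] at h
  have h' : q * sineMoment q 1 = 0 := by linarith
  exact (mul_eq_zero.mp h').resolve_left (by linarith)

lemma sineMoment_eq {q : ℝ} (hq : 1 < q) (n : ℕ) :
    sineMoment q n = if Even n then q ^ (-(n : ℝ) / 2) else 0 := by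
  induction n using Nat.twoStepInduction with
  | zero => simp [sineMoment_zero hq]
  | one => simp [sineMoment_one hq]
  | more n ih _ =>
    have hpow : q ^ (-((n + 2 : ℕ) : ℝ) / 2) = q⁻¹ * q ^ (-(n : ℝ) / 2) := by
      rw [← rpow_neg_one q, ← rpow_add (by linarith)]
      congr 1
      push_cast
      ring
    have heven : Even (n + 2) ↔ Even n := by simp [Nat.even_add]
    rw [sineMoment_add_two hq, ih, hpow]
    simp only [heven, mul_ite, mul_zero]

/-- For real `q > 1` and `m ≥ 0`, the integral of `U_m(cos θ)` against the measure
`μ_q` with density `[(q + 1)/((q^{1/2} + q^{−1/2})² − 4cos²θ)] · (2/π) sin²θ dθ` on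
`[0,π]` equals `q^{−m/2}` if `m` is even and `0` if `m` is odd. -/
theorem integral_chebyshevU_mu_q (q : ℝ) (hq : 1 < q) (m : ℕ) :
    (∫ θ in (0:ℝ)..π,
        (Polynomial.Chebyshev.U ℝ m).eval (Real.cos θ) *
          ((q + 1) / ((Real.sqrt q + (Real.sqrt q)⁻¹) ^ 2 - 4 * Real.cos θ ^ 2)) *
          ((2 / π) * Real.sin θ ^ 2)) =
      if Even m then q ^ (-(m : ℝ) / 2) else 0 := by
  rw [← sineMoment_eq hq m]
  refine intervalIntegral.integral_congr fun θ _ ↦ ?_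
  have hq0 : 0 < q := by linarith
  have hs : (√q + (√q)⁻¹) ^ 2 - 4 * cos θ ^ 2 = q + q⁻¹ - 2 * cos (2 * θ) := by
    have h1 : √q ^ 2 = q := sq_sqrt hq0.le
    have h2 : √q * (√q)⁻¹ = 1 := mul_inv_cancel₀ (sqrt_pos.mpr hq0).ne'
    have h3 : (√q)⁻¹ ^ 2 = q⁻¹ := by rw [inv_pow, h1]
    rw [cos_two_mul]
    linear_combination h1 + 2 * h2 + h3
  have hU := Polynomial.Chebyshev.U_real_cos θ m
  push_cast at hU
  simp only [hs, ← hU]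
  ring
end

section
/- There exists a constant C > 0 such that for every real q ≥ 2, every real B > 0, and every measurable function Z : [0,π] → ℝ with |Z(θ)| ≤ B for all θ ∈ [0,π], one has |∫_0^π Z(θ) dμ_q(θ) − ∫_0^π Z(θ) dμ_∞(θ)| ≤ C·B/q. -/
open Real

lemma sqrt_add_inv_sqrt_sq {q : ℝ} (hq : 0 < q) : (√q + (√q)⁻¹) ^ 2 = q + 2 + q⁻¹ := by
  have hs : √q ≠ 0 := (Real.sqrt_pos.2 hq).ne'
  have h : (√q + (√q)⁻¹) ^ 2 = √q ^ 2 + 2 + (√q ^ 2)⁻¹ := by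
    field_simp
    ring
  rw [h, Real.sq_sqrt hq.le]

lemma div_four_le_mu_q_denominator {q : ℝ} (hq : 2 ≤ q) (θ : ℝ) :
    q / 4 ≤ (√q + (√q)⁻¹) ^ 2 - 4 * Real.cos θ ^ 2 := by
  have hq0 : 0 < q := by linarith
  rw [sqrt_add_inv_sqrt_sq hq0]
  have hinv : 0 < q⁻¹ := inv_pos.2 hq0
  have hqi : q * q⁻¹ = 1 := mul_inv_cancel₀ hq0.ne'
  have hbound : q / 4 ≤ q - 2 + q⁻¹ := by
    have h : q - 2 + q⁻¹ - q / 4 = (q - 2) * (3 * q - 2) / (4 * q) := by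
      field_simp
      ring
    have : 0 ≤ (q - 2) * (3 * q - 2) / (4 * q) :=
      div_nonneg (mul_nonneg (by linarith) (by linarith)) (by linarith)
    linarith
  linarith [Real.cos_sq_le_one θ]

lemma abs_mu_q_density_ratio_sub_one_le {q : ℝ} (hq : 2 ≤ q) (θ : ℝ) :
    |(q + 1) / ((√q + (√q)⁻¹) ^ 2 - 4 * Real.cos θ ^ 2) - 1| ≤ 12 / q := by
  have hq0 : 0 < q := by linarith
  have hD := div_four_le_mu_q_denominator hq θ
  have hD0 : 0 < (√q + (√q)⁻¹) ^ 2 - 4 * Real.cos θ ^ 2 := by linarith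
  have hinv : 0 < q⁻¹ := inv_pos.2 hq0
  have hinv1 : q⁻¹ ≤ 1 := inv_le_one_of_one_le₀ (by linarith)
  rw [div_sub_one hD0.ne', abs_div, abs_of_pos hD0]
  calc _ ≤ 3 / (q / 4) := by
        gcongr
        rw [sqrt_add_inv_sqrt_sq hq0, abs_le]
        constructor <;> linarith [Real.cos_sq_le_one θ, sq_nonneg (Real.cos θ)]
    _ = 12 / q := by
        field_simp
        norm_num

/-- There is a constant `C > 0` such that for every real `q ≥ 2`, every `B > 0` and
every measurable function `Z` bounded by `B` on `[0,π]`, the integral of `Z` against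
the measure `μ_q` (density `[(q + 1)/((q^{1/2} + q^{−1/2})² − 4cos²θ)] · (2/π) sin²θ`)
is within `C·B/q` of the integral of `Z` against the Sato–Tate measure `μ_∞`
(density `(2/π) sin²θ`). -/
theorem integral_mu_q_close_to_integral_mu_infty :
    ∃ C : ℝ, 0 < C ∧ ∀ q : ℝ, 2 ≤ q → ∀ B : ℝ, 0 < B → ∀ Z : ℝ → ℝ,
      Measurable Z → (∀ θ ∈ Set.Icc (0:ℝ) π, |Z θ| ≤ B) →
      |(∫ θ in (0:ℝ)..π, Z θ *
            ((q + 1) / ((Real.sqrt q + (Real.sqrt q)⁻¹) ^ 2 - 4 * Real.cos θ ^ 2)) *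
            ((2 / π) * Real.sin θ ^ 2)) -
        (∫ θ in (0:ℝ)..π, Z θ * ((2 / π) * Real.sin θ ^ 2))| ≤ C * B / q := by
  refine ⟨24, by norm_num, fun q hq B hB Z hZ hZB => ?_⟩
  have hD (θ : ℝ) : (√q + (√q)⁻¹) ^ 2 - 4 * Real.cos θ ^ 2 ≠ 0 := by
    linarith [div_four_le_mu_q_denominator hq θ]
  have hZi : IntervalIntegrable Z MeasureTheory.volume 0 π := by
    rw [intervalIntegrable_iff_integrableOn_Icc_of_le Real.pi_pos.le]
    refine MeasureTheory.Measure.integrableOn_of_bounded (M := B) (by simp)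
      hZ.aestronglyMeasurable ?_
    exact (MeasureTheory.ae_restrict_iff' measurableSet_Icc).2 (.of_forall hZB)
  rw [← intervalIntegral.integral_sub]
  · have hbound : ∀ θ ∈ Set.uIoc 0 π,
        ‖Z θ * ((q + 1) / ((√q + (√q)⁻¹) ^ 2 - 4 * Real.cos θ ^ 2)) *
          ((2 / π) * Real.sin θ ^ 2) - Z θ * ((2 / π) * Real.sin θ ^ 2)‖ ≤
        B * (12 / q) * (2 / π * 1) := by
      intro θ hθ
      rw [Set.uIoc_of_le Real.pi_pos.le] at hθ
      have hfactor : Z θ * ((q + 1) / ((√q + (√q)⁻¹) ^ 2 - 4 * Real.cos θ ^ 2)) *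
          ((2 / π) * Real.sin θ ^ 2) - Z θ * ((2 / π) * Real.sin θ ^ 2) =
          Z θ * ((q + 1) / ((√q + (√q)⁻¹) ^ 2 - 4 * Real.cos θ ^ 2) - 1) *
          ((2 / π) * Real.sin θ ^ 2) := by ring
      rw [hfactor, Real.norm_eq_abs, abs_mul, abs_mul,
        abs_of_nonneg (by positivity : 0 ≤ 2 / π * Real.sin θ ^ 2)]
      gcongr
      · exact hZB θ (Set.Ioc_subset_Icc_self hθ)
      · exact abs_mu_q_density_ratio_sub_one_le hq θ
      · exact Real.sin_sq_le_one θ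
    refine (intervalIntegral.norm_integral_le_of_norm_le_const hbound).trans_eq ?_
    rw [sub_zero, abs_of_pos Real.pi_pos]
    field_simp
    norm_num
  · refine (hZi.mul_continuousOn ?_).mul_continuousOn (by fun_prop)
    exact (continuous_const.div (by fun_prop) hD).continuousOn
  · exact hZi.mul_continuousOn (by fun_prop)
end

section
/- There exists a constant C > 0 such that the following holds. Let q ≥ 2 be real, M a positive integer, c_1, …, c_M real numbers, and set Z(θ) = ∑_{m=1}^M c_m U_m(cos θ). If |Z(θ)| ≤ B for all θ ∈ [0,π], then |∫_0^π Z(θ) dμ_q(θ)| ≤ C·B/q. -/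
open Real Polynomial

theorem integral_chebyshevU_mul_sin_sq {m : ℕ} (hm : 0 < m) :
    ∫ θ in (0:ℝ)..π, (Polynomial.Chebyshev.U ℝ m).eval (Real.cos θ) * Real.sin θ ^ 2 = 0 := by
  have cos_zero (k : ℕ) (hk : 0 < k) : ∫ θ in (0:ℝ)..π, Real.cos (k * θ) = 0 := by
    have hk' : (k : ℝ) ≠ 0 := by positivity
    rw [intervalIntegral.integral_comp_mul_left _ hk', integral_cos, Real.sin_nat_mul_pi]
    simp
  have h (θ : ℝ) : (Polynomial.Chebyshev.U ℝ m).eval (Real.cos θ) * Real.sin θ ^ 2 =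
      (Real.cos ((m : ℕ) * θ) - Real.cos ((m + 2 : ℕ) * θ)) * (1 / 2) := by
    have hU := Polynomial.Chebyshev.U_real_cos θ m
    have h1 : ((m : ℕ) : ℝ) * θ = (m + 1) * θ - θ := by ring
    have h2 : ((m + 2 : ℕ) : ℝ) * θ = (m + 1) * θ + θ := by push_cast; ring
    rw [h1, h2, Real.cos_sub, Real.cos_add, sq, ← mul_assoc, hU]
    push_cast
    ring
  simp_rw [h]
  rw [intervalIntegral.integral_mul_const, intervalIntegral.integral_sub
    (Continuous.intervalIntegrable (by fun_prop) _ _)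
    (Continuous.intervalIntegrable (by fun_prop) _ _), cos_zero m hm, cos_zero (m + 2) (by omega)]
  simp

theorem integral_chebyshevU_sum_mul_sin_sq (M : ℕ) (c : ℕ → ℝ) :
    ∫ θ in (0:ℝ)..π,
      (∑ m ∈ Finset.Icc 1 M, c m * (Polynomial.Chebyshev.U ℝ m).eval (Real.cos θ)) *
        ((2 / π) * Real.sin θ ^ 2) = 0 := by
  have h (θ : ℝ) :
      (∑ m ∈ Finset.Icc 1 M, c m * (Polynomial.Chebyshev.U ℝ m).eval (Real.cos θ)) *
        ((2 / π) * Real.sin θ ^ 2) =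
      ∑ m ∈ Finset.Icc 1 M, (c m * (2 / π)) *
        ((Polynomial.Chebyshev.U ℝ m).eval (Real.cos θ) * Real.sin θ ^ 2) := by
    rw [Finset.sum_mul]
    exact Finset.sum_congr rfl fun m _ => by ring
  simp_rw [h]
  rw [intervalIntegral.integral_finsetSum
    fun m _ => Continuous.intervalIntegrable (by fun_prop) _ _]
  refine Finset.sum_eq_zero fun m hm => ?_
  rw [intervalIntegral.integral_const_mul,
    integral_chebyshevU_mul_sin_sq (Finset.mem_Icc.mp hm).1, mul_zero]

theorem sqrt_add_inv_sqrt_sq_sub_lower {q x : ℝ} (hq : 2 ≤ q) (hx : x ^ 2 ≤ 1) :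
    q / 4 ≤ (Real.sqrt q + (Real.sqrt q)⁻¹) ^ 2 - 4 * x ^ 2 := by
  have hq0 : 0 < q := by linarith
  rw [add_sq, inv_pow, Real.sq_sqrt hq0.le, mul_assoc,
    mul_inv_cancel₀ (Real.sqrt_pos.mpr hq0).ne']
  have h : q / 4 ≤ q - 2 + q⁻¹ := by
    have : q - 2 + q⁻¹ - q / 4 = (3 * q - 2) * (q - 2) / (4 * q) := by field_simp; ring
    have : 0 ≤ (3 * q - 2) * (q - 2) / (4 * q) :=
      div_nonneg (mul_nonneg (by linarith) (by linarith)) (by linarith)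
    linarith
  linarith

theorem abs_density_sub_one_le {q x : ℝ} (hq : 2 ≤ q) (hx : x ^ 2 ≤ 1) :
    |(q + 1) / ((Real.sqrt q + (Real.sqrt q)⁻¹) ^ 2 - 4 * x ^ 2) - 1| ≤ 16 / q := by
  have hq0 : 0 < q := by linarith
  have hD := sqrt_add_inv_sqrt_sq_sub_lower hq hx
  have hE : (Real.sqrt q + (Real.sqrt q)⁻¹) ^ 2 = q + 2 + q⁻¹ := by
    rw [add_sq, inv_pow, Real.sq_sqrt hq0.le, mul_assoc,
      mul_inv_cancel₀ (Real.sqrt_pos.mpr hq0).ne']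
    ring
  have hinv : q⁻¹ ≤ 1 := inv_le_one_of_one_le₀ (by linarith)
  have hinv0 : 0 < q⁻¹ := inv_pos.mpr hq0
  rw [hE] at hD ⊢
  have hD0 : 0 < q + 2 + q⁻¹ - 4 * x ^ 2 := by linarith
  rw [div_sub_one hD0.ne', abs_div, abs_of_pos hD0, div_le_div_iff₀ hD0 hq0]
  have hN : |q + 1 - (q + 2 + q⁻¹ - 4 * x ^ 2)| ≤ 4 :=
    abs_le.mpr ⟨by linarith [sq_nonneg x], by linarith⟩
  linarith [mul_le_mul_of_nonneg_right hN hq0.le]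

/-- There is a constant `C > 0` such that the following holds: for real `q ≥ 2`, a
positive integer `M` and reals `c_1, …, c_M`, if `Z(θ) = ∑_{m=1}^M c_m U_m(cos θ)`
satisfies `|Z(θ)| ≤ B` on `[0,π]`, then the integral of `Z` against the measure `μ_q`
(density `[(q + 1)/((q^{1/2} + q^{−1/2})² − 4cos²θ)] · (2/π) sin²θ`) is at most
`C·B/q` in absolute value. -/
theorem integral_chebyshev_sum_mu_q_small :
    ∃ C : ℝ, 0 < C ∧ ∀ q : ℝ, 2 ≤ q → ∀ M : ℕ, 0 < M → ∀ c : ℕ → ℝ, ∀ B : ℝ,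
      (∀ θ ∈ Set.Icc (0:ℝ) π,
        |∑ m ∈ Finset.Icc 1 M, c m * (Polynomial.Chebyshev.U ℝ m).eval (Real.cos θ)|
          ≤ B) →
      |∫ θ in (0:ℝ)..π,
          (∑ m ∈ Finset.Icc 1 M, c m * (Polynomial.Chebyshev.U ℝ m).eval (Real.cos θ)) *
            ((q + 1) / ((Real.sqrt q + (Real.sqrt q)⁻¹) ^ 2 - 4 * Real.cos θ ^ 2)) *
            ((2 / π) * Real.sin θ ^ 2)| ≤ C * B / q := by
  refine ⟨32, by norm_num, fun q hq M _ c B hB => ?_⟩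
  have hq0 : 0 < q := by linarith
  have hcos (θ : ℝ) : Real.cos θ ^ 2 ≤ 1 := Real.cos_sq_le_one θ
  have hD (θ : ℝ) : (Real.sqrt q + (Real.sqrt q)⁻¹) ^ 2 - 4 * Real.cos θ ^ 2 ≠ 0 :=
    ((by positivity : 0 < q / 4).trans_le (sqrt_add_inv_sqrt_sq_sub_lower hq (hcos θ))).ne'
  have hB0 : 0 ≤ B := (abs_nonneg _).trans (hB 0 ⟨le_rfl, Real.pi_pos.le⟩)
  rw [← sub_zero (intervalIntegral _ _ _ _)]
  nth_rewrite 2 [← integral_chebyshevU_sum_mul_sin_sq M c]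
  rw [← intervalIntegral.integral_sub
      (Continuous.intervalIntegrable (by fun_prop (disch := exact hD _)) _ _)
      (Continuous.intervalIntegrable (by fun_prop) _ _)]
  have key := intervalIntegral.norm_integral_le_of_norm_le_const (a := 0) (b := π)
    (C := B * (16 / q) * (2 / π))
    (f := fun θ => (∑ m ∈ Finset.Icc 1 M,
        c m * (Polynomial.Chebyshev.U ℝ m).eval (Real.cos θ)) *
      ((q + 1) / ((Real.sqrt q + (Real.sqrt q)⁻¹) ^ 2 - 4 * Real.cos θ ^ 2)) *
      ((2 / π) * Real.sin θ ^ 2) -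
      (∑ m ∈ Finset.Icc 1 M, c m * (Polynomial.Chebyshev.U ℝ m).eval (Real.cos θ)) *
      ((2 / π) * Real.sin θ ^ 2)) fun θ hθ => by
    rw [Set.uIoc_of_le Real.pi_pos.le] at hθ
    rw [Real.norm_eq_abs, ← sub_mul, ← mul_sub_one, abs_mul, abs_mul]
    have hs : |2 / π * Real.sin θ ^ 2| ≤ 2 / π := by
      rw [abs_of_nonneg (by positivity)]
      exact mul_le_of_le_one_right (by positivity) (Real.sin_sq_le_one θ)
    gcongr
    · exact hB θ ⟨hθ.1.le, hθ.2⟩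
    · exact abs_density_sub_one_le hq (hcos θ)
  rw [Real.norm_eq_abs, sub_zero, abs_of_pos Real.pi_pos] at key
  refine key.trans_eq ?_
  field_simp
  ring
end

section
/- Let I = [a,b] ⊆ [0,π]. There exists a constant C > 0 (depending only on I) such that for every integer M ≥ 2, |∑_{m=1}^M ĉ_m(I)² − (μ_∞(I) − μ_∞(I)²)| ≤ C·(log M)/M, where ĉ_m(I) is the m-th Chebyshev–Fourier coefficient of the indicator of I. -/
open Real Polynomial

open MeasureTheory Set in
/-- Integrating a function restricted to `(a, b] ∪ (-b, -a]` over `[-π, π]`. -/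
theorem integral_indicator_symm_Ioc {E : Type*} [NormedAddCommGroup E] [NormedSpace ℝ E]
    {a b : ℝ} (ha : 0 ≤ a) (hab : a ≤ b) (hb : b ≤ π) {F : ℝ → E} (hF : Continuous F) :
    ∫ x in (-π)..π, (Ioc a b ∪ Ioc (-b) (-a)).indicator F x = ∫ x in a..b, (F x + F (-x)) := by
  have hdisj : Disjoint (Ioc a b) (Ioc (-b) (-a)) :=
    Set.disjoint_left.2 fun x hx hx' => by linarith [hx.1, hx'.2]
  have hsub : Ioc a b ∪ Ioc (-b) (-a) ⊆ Ioc (-π) π := by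
    rintro x (⟨h1, h2⟩ | ⟨h1, h2⟩) <;> constructor <;> linarith [pi_pos]
  rw [intervalIntegral.integral_of_le (by linarith [pi_pos]),
    setIntegral_indicator (measurableSet_Ioc.union measurableSet_Ioc), inter_eq_right.2 hsub,
    setIntegral_union hdisj measurableSet_Ioc hF.integrableOn_Ioc hF.integrableOn_Ioc,
    ← intervalIntegral.integral_of_le hab, ← intervalIntegral.integral_of_le (by linarith),
    intervalIntegral.integral_add (hF.intervalIntegrable _ _)
      (Continuous.intervalIntegrable (by fun_prop) _ _),
    intervalIntegral.integral_comp_neg]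

open MeasureTheory Set in
/-- The Fourier coefficients on `[-π, π]` of an odd function restricted to
`(a, b] ∪ (-b, -a]`. -/
theorem norm_sq_fourierCoeffOn_indicator_symm {a b : ℝ} (ha : 0 ≤ a) (hab : a ≤ b) (hb : b ≤ π)
    {h : ℝ → ℝ} (hh : Continuous h) (hodd : ∀ x, h (-x) = -h x) (hπ : -π < π) (n : ℤ) :
    ‖fourierCoeffOn hπ ((Ioc a b ∪ Ioc (-b) (-a)).indicator fun x => (h x : ℂ)) n‖ ^ 2 =
      (1 / π * ∫ x in a..b, h x * sin (n * x)) ^ 2 := by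
  have hexp (x : ℝ) : fourier (-n) (x : AddCircle (π - -π)) =
      Complex.exp (-(n * x) * Complex.I) := by
    rw [fourier_coe_apply]
    congr 1
    push_cast
    have : (π : ℂ) ≠ 0 := by exact_mod_cast pi_ne_zero
    field_simp
    ring
  have hind : (fun x : ℝ => fourier (-n) (x : AddCircle (π - -π)) •
      (Ioc a b ∪ Ioc (-b) (-a)).indicator (fun x => (h x : ℂ)) x) =
      (Ioc a b ∪ Ioc (-b) (-a)).indicator
        fun x : ℝ => Complex.exp (-(n * x) * Complex.I) * (h x : ℂ) := by
    funext x
    rw [hexp, smul_eq_mul]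
    by_cases hx : x ∈ Ioc a b ∪ Ioc (-b) (-a) <;> simp only [hx, indicator_of_mem,
      indicator_of_notMem, not_false_eq_true, mul_zero]
  have hsum (x : ℝ) : Complex.exp (-(n * x) * Complex.I) * (h x : ℂ) +
      Complex.exp (-(n * (-x : ℝ)) * Complex.I) * (h (-x) : ℂ) =
      (-2 * Complex.I) * ((h x * sin (n * x) : ℝ) : ℂ) := by
    rw [hodd]
    push_cast
    rw [Complex.sin, mul_neg (n : ℂ), neg_neg (n * x : ℂ)]
    linear_combination ((h x : ℂ) * (Complex.exp (-(n * x) * Complex.I)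
      - Complex.exp (n * x * Complex.I))) * Complex.I_sq
  rw [fourierCoeffOn_eq_integral, hind, integral_indicator_symm_Ioc ha hab hb (by fun_prop)]
  simp_rw [hsum]
  rw [intervalIntegral.integral_const_mul, intervalIntegral.integral_ofReal, norm_smul, norm_mul,
    Complex.norm_real, norm_mul, Complex.norm_I, mul_pow, mul_pow, norm_eq_abs, norm_eq_abs,
    sq_abs, sq_abs]
  simp
  field_simp
  ring

open MeasureTheory Set in
/-- Parseval's identity for the sine coefficients of a function restricted to
`[a, b] ⊆ [0, π]`. -/
theorem hasSum_sq_sine_coeff {a b : ℝ} (ha : 0 ≤ a) (hab : a ≤ b) (hb : b ≤ π)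
    {h : ℝ → ℝ} (hh : Continuous h) (hodd : ∀ x, h (-x) = -h x) :
    HasSum (fun n : ℕ => (2 / π * ∫ x in a..b, h x * sin ((n + 1) * x)) ^ 2)
      (2 / π * ∫ x in a..b, h x ^ 2) := by
  have hπ : -π < π := by linarith [pi_pos]
  have hcont : Continuous fun x => (h x : ℂ) := by fun_prop
  have hL2 : MemLp ((Ioc a b ∪ Ioc (-b) (-a)).indicator fun x => (h x : ℂ)) 2
      (volume.restrict (Ioc (-π) π)) := by
    refine MemLp.indicator (measurableSet_Ioc.union measurableSet_Ioc) ?_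
    have := hcont.continuousOn (s := Icc (-π) π)
    obtain ⟨K, hK⟩ := isCompact_Icc.exists_bound_of_continuousOn this
    refine MemLp.of_bound hcont.aestronglyMeasurable K ?_
    exact (ae_restrict_mem measurableSet_Ioc).mono fun x hx => hK x (Ioc_subset_Icc_self hx)
  have hS := hasSum_sq_fourierCoeffOn hπ hL2
  have hnorm : (fun x => ‖(Ioc a b ∪ Ioc (-b) (-a)).indicator (fun x => (h x : ℂ)) x‖ ^ 2) =
      (Ioc a b ∪ Ioc (-b) (-a)).indicator fun x => h x ^ 2 := by
    funext x
    by_cases hx : x ∈ Ioc a b ∪ Ioc (-b) (-a) <;> simp only [hx, indicator_of_mem,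
      indicator_of_notMem, not_false_eq_true, Complex.norm_real, norm_eq_abs, sq_abs, norm_zero,
      ne_eq, OfNat.ofNat_ne_zero, zero_pow]
  rw [hnorm, integral_indicator_symm_Ioc ha hab hb (by fun_prop)] at hS
  simp_rw [norm_sq_fourierCoeffOn_indicator_symm ha hab hb hh hodd, hodd, neg_sq, ← two_mul] at hS
  have hN := ((hasSum_nat_add_iff' 1).2 hS.nat_add_neg).mul_left 2
  convert hN using 1
  · rfl
  · funext n
    have : (fun x => h x * sin (((-((n + 1 : ℕ) : ℤ) : ℤ) : ℝ) * x)) =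
        fun x => -(h x * sin ((n + 1) * x)) := by
      funext x
      push_cast
      rw [neg_mul, sin_neg, mul_neg]
    rw [this, intervalIntegral.integral_neg]
    push_cast
    ring
  · rw [intervalIntegral.integral_const_mul]
    simp
    field_simp
    ring

theorem abs_integral_cos_mul_le (a b : ℝ) {k : ℝ} (hk : 0 < k) :
    |∫ x in a..b, cos (k * x)| ≤ 2 / k := by
  rw [intervalIntegral.integral_comp_mul_left _ hk.ne', integral_cos, smul_eq_mul, abs_mul,
    abs_of_pos (inv_pos.2 hk), div_eq_inv_mul]
  gcongr
  rw [abs_le]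
  constructor <;>
    linarith [neg_one_le_sin (k * b), sin_le_one (k * b), neg_one_le_sin (k * a),
      sin_le_one (k * a)]

theorem abs_integral_sin_mul_sin_le (a b : ℝ) {k : ℝ} (hk : 0 < k) :
    |∫ x in a..b, sin x * sin ((k + 1) * x)| ≤ 2 / k := by
  have hprod (x : ℝ) :
      sin x * sin ((k + 1) * x) = 1 / 2 * (cos (k * x) - cos ((k + 2) * x)) := by
    have h1 : k * x = (k + 1) * x - x := by ring
    have h2 : (k + 2) * x = (k + 1) * x + x := by ring
    rw [h1, h2, cos_sub, cos_add]
    ring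
  simp_rw [hprod]
  rw [intervalIntegral.integral_const_mul, intervalIntegral.integral_sub
    (Continuous.intervalIntegrable (by fun_prop) _ _)
    (Continuous.intervalIntegrable (by fun_prop) _ _), abs_mul, abs_of_pos (by norm_num)]
  have h1 := abs_integral_cos_mul_le a b hk
  have h2 := abs_integral_cos_mul_le a b (k := k + 2) (by linarith)
  have h3 : 2 / (k + 2) ≤ 2 / k := by gcongr; linarith
  have h4 := abs_sub (∫ x in a..b, cos (k * x)) (∫ x in a..b, cos ((k + 2) * x))
  linarith

/-- Tail estimate for a convergent series with terms bounded by `K / n ^ 2`. -/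
theorem HasSum.abs_sum_range_sub_le {f : ℕ → ℝ} {s K : ℝ} (hf : HasSum f s) (h0 : ∀ n, 0 ≤ f n)
    (hK : ∀ n, 0 < n → f n ≤ K * ((n : ℝ) ^ 2)⁻¹) {M : ℕ} (hM : 0 < M) :
    |∑ n ∈ Finset.range (M + 1), f n - s| ≤ K / M := by
  have hK0 : 0 ≤ K := by simpa using (h0 1).trans (hK 1 one_pos)
  have hle := sum_le_hasSum (Finset.range (M + 1)) (fun n _ => h0 n) hf
  have hlim : s ≤ ∑ n ∈ Finset.range (M + 1), f n + K / M := by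
    refine le_of_tendsto hf.tendsto_sum_nat (Filter.eventually_atTop.2 ⟨M + 1, fun N hN => ?_⟩)
    obtain ⟨N, rfl⟩ : ∃ L, N = L + 1 := ⟨N - 1, by omega⟩
    rw [← Finset.sum_range_add_sum_Ico f hN]
    have hIco : Finset.Ico (M + 1) (N + 1) = Finset.Ioc M N := by
      ext
      simp only [Finset.mem_Ico, Finset.mem_Ioc]
      omega
    have hsum : ∑ n ∈ Finset.Ioc M N, f n ≤ K * ∑ n ∈ Finset.Ioc M N, ((n : ℝ) ^ 2)⁻¹ := by
      rw [Finset.mul_sum]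
      exact Finset.sum_le_sum fun n hn => hK n (by have := Finset.mem_Ioc.1 hn; omega)
    have hinv := sum_Ioc_inv_sq_le_sub (α := ℝ) hM.ne' (by omega : M ≤ N)
    have hinv' : ∑ n ∈ Finset.Ioc M N, ((n : ℝ) ^ 2)⁻¹ ≤ (M : ℝ)⁻¹ :=
      hinv.trans (sub_le_self _ (by positivity))
    have := mul_le_mul_of_nonneg_left hinv' hK0
    rw [hIco, div_eq_mul_inv]
    linarith
  rw [abs_le]
  constructor
  · linarith
  · have : 0 ≤ K / M := by positivity
    linarith

/-- For `I = [a,b] ⊆ [0,π]` there is a constant `C > 0` (depending only on `I`) such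
that for every integer `M ≥ 2`, the partial sum `∑_{m=1}^M ĉ_m(I)²` of squares of
Chebyshev–Fourier coefficients of the indicator of `I` is within `C·(log M)/M` of
`μ_∞(I) − μ_∞(I)²`. -/
theorem partial_parseval_indicator_chebyshev (a b : ℝ) (ha : 0 ≤ a) (hab : a ≤ b)
    (hb : b ≤ π) (c : ℕ → ℝ)
    (hc : ∀ m : ℕ, c m = (2 / π) * ∫ θ in a..b,
        (Polynomial.Chebyshev.U ℝ m).eval (Real.cos θ) * Real.sin θ ^ 2)
    (μI : ℝ) (hμ : μI = (2 / π) * ∫ θ in a..b, Real.sin θ ^ 2) :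
    ∃ C : ℝ, 0 < C ∧ ∀ M : ℕ, 2 ≤ M →
      |(∑ m ∈ Finset.Icc 1 M, c m ^ 2) - (μI - μI ^ 2)| ≤ C * Real.log M / M := by
  have hc' (m : ℕ) : c m = 2 / π * ∫ x in a..b, sin x * sin ((m + 1) * x) := by
    rw [hc]
    congr 2
    funext x
    have := Polynomial.Chebyshev.U_real_cos x m
    push_cast at this
    rw [← this]
    ring
  have hc0 : c 0 = μI := by simp [hc, hμ]
  have hsum : HasSum (fun m => c m ^ 2) μI := by
    simp_rw [hc', hμ]
    exact hasSum_sq_sine_coeff ha hab hb continuous_sin sin_neg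
  have hbound (m : ℕ) (hm : 0 < m) : c m ^ 2 ≤ 4 * ((m : ℝ) ^ 2)⁻¹ := by
    have hm' : (0 : ℝ) < m := by exact_mod_cast hm
    have hπ : 2 / π ≤ 1 := (div_le_one pi_pos).2 two_le_pi
    have habs : |c m| ≤ 2 / m := by
      rw [hc', abs_mul, abs_of_pos (by positivity)]
      exact (mul_le_of_le_one_left (abs_nonneg _) hπ).trans (abs_integral_sin_mul_sin_le a b hm')
    calc c m ^ 2 = |c m| ^ 2 := (sq_abs _).symm
      _ ≤ (2 / m) ^ 2 := by gcongr
      _ = 4 * ((m : ℝ) ^ 2)⁻¹ := by rw [div_pow, div_eq_mul_inv]; norm_num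
  refine ⟨8, by norm_num, fun M hM => ?_⟩
  have htail := hsum.abs_sum_range_sub_le (fun _ => sq_nonneg _) hbound (by omega : 0 < M)
  have hsplit : ∑ m ∈ Finset.range (M + 1), c m ^ 2 =
      μI ^ 2 + ∑ m ∈ Finset.Icc 1 M, c m ^ 2 := by
    rw [Finset.range_eq_Ico, Finset.sum_eq_sum_Ico_succ_bot (by omega), hc0]
    congr 2
  have hlog : 1 / 2 ≤ log M := by
    have : log 2 ≤ log M := log_le_log (by norm_num) (by exact_mod_cast hM)
    linarith [log_two_gt_d9]
  calc |(∑ m ∈ Finset.Icc 1 M, c m ^ 2) - (μI - μI ^ 2)|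
      = |∑ m ∈ Finset.range (M + 1), c m ^ 2 - μI| := by rw [hsplit]; congr 1; ring
    _ ≤ 4 / M := htail
    _ ≤ 8 * log M / M := by gcongr; linarith
end

section
/- There exists a constant C > 0 such that for every interval I = [a,b] ⊆ [0,π] and every positive integer M, there exist real numbers f_0^+, …, f_M^+ and f_0^−, …, f_M^− with the following properties: (i) for all θ ∈ [0,π], ∑_{m=0}^M f_m^− U_m(cos θ) ≤ χ_I(θ) ≤ ∑_{m=0}^M f_m^+ U_m(cos θ), where χ_I is the indicator function of I; (ii) for all 0 ≤ m ≤ M, |f_m^± − ĉ_m(I)| ≤ C/(M+1), where ĉ_m(I) is the m-th Chebyshev–Fourier coefficient of the indicator of I. -/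
open Real Polynomial

open Finset MeasureTheory intervalIntegral

theorem integral_cos_int_mul (n : ℤ) :
    ∫ s in (0:ℝ)..π, cos (n * s) = if n = 0 then π else 0 := by
  split_ifs with h
  · simp [h]
  · have h' : (n : ℝ) ≠ 0 := by exact_mod_cast h
    rw [intervalIntegral.integral_comp_mul_left (fun x => cos x) h', integral_cos]
    simp [Real.sin_int_mul_pi]

/-- Coefficients of the Fejér–Korovkin kernel. -/
noncomputable def korovkinCoeff (M k : ℕ) : ℝ := sin (π / (M + 2) * (k + 1))

/-- The squared `ℓ²` norm of the Fejér–Korovkin coefficients. -/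
noncomputable def korovkinNorm (M : ℕ) : ℝ := ∑ j ∈ range (M + 1), korovkinCoeff M j ^ 2

/-- The (unnormalised) Fejér–Korovkin kernel. -/
noncomputable def korovkinKernel (M : ℕ) (t : ℝ) : ℝ :=
  ∑ j ∈ range (M + 1), ∑ k ∈ range (M + 1),
    korovkinCoeff M j * korovkinCoeff M k * cos (((j : ℤ) - (k : ℤ) : ℤ) * t)

/-- The even, normalised version of the Fejér–Korovkin kernel on `[0, π]`. -/
noncomputable def evenKernel (M : ℕ) (θ s : ℝ) : ℝ :=
  (korovkinKernel M (θ - s) + korovkinKernel M (θ + s)) / (2 * π * korovkinNorm M)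

theorem korovkinCoeff_zero_pos (M : ℕ) : 0 < korovkinCoeff M 0 := by
  unfold korovkinCoeff
  have hM : (0:ℝ) ≤ M := Nat.cast_nonneg M
  apply Real.sin_pos_of_pos_of_lt_pi
  · positivity
  · rw [Nat.cast_zero, zero_add, mul_one, div_lt_iff₀ (by positivity)]
    nlinarith [pi_pos]

theorem korovkinNorm_pos (M : ℕ) : 0 < korovkinNorm M :=
  Finset.sum_pos' (fun _ _ => sq_nonneg _) ⟨0, by simp, pow_pos (korovkinCoeff_zero_pos M) 2⟩

theorem korovkinKernel_nonneg (M : ℕ) (t : ℝ) : 0 ≤ korovkinKernel M t := by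
  have h : korovkinKernel M t = (∑ j ∈ range (M + 1), korovkinCoeff M j * cos (j * t)) ^ 2 +
      (∑ j ∈ range (M + 1), korovkinCoeff M j * sin (j * t)) ^ 2 := by
    rw [korovkinKernel, sq, sq, sum_mul_sum, sum_mul_sum, ← sum_add_distrib]
    refine sum_congr rfl fun j _ => ?_
    rw [← sum_add_distrib]
    refine sum_congr rfl fun k _ => ?_
    push_cast
    rw [sub_mul, cos_sub]
    ring
  rw [h]
  positivity

theorem evenKernel_nonneg (M : ℕ) (θ s : ℝ) : 0 ≤ evenKernel M θ s := by
  have := korovkinNorm_pos M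
  have := korovkinKernel_nonneg M (θ - s)
  have := korovkinKernel_nonneg M (θ + s)
  unfold evenKernel
  positivity

theorem evenKernel_eq (M : ℕ) (θ s : ℝ) :
    evenKernel M θ s = (π * korovkinNorm M)⁻¹ * ∑ j ∈ range (M + 1), ∑ k ∈ range (M + 1),
      korovkinCoeff M j * korovkinCoeff M k * cos (((j : ℤ) - (k : ℤ) : ℤ) * θ) *
        cos (((j : ℤ) - (k : ℤ) : ℤ) * s) := by
  have h : korovkinKernel M (θ - s) + korovkinKernel M (θ + s) =
      2 * ∑ j ∈ range (M + 1), ∑ k ∈ range (M + 1),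
      korovkinCoeff M j * korovkinCoeff M k * cos (((j : ℤ) - (k : ℤ) : ℤ) * θ) *
        cos (((j : ℤ) - (k : ℤ) : ℤ) * s) := by
    rw [korovkinKernel, korovkinKernel, ← sum_add_distrib, mul_sum]
    refine sum_congr rfl fun j _ => ?_
    rw [← sum_add_distrib, mul_sum]
    refine sum_congr rfl fun k _ => ?_
    rw [mul_sub, mul_add, cos_sub, cos_add]
    ring
  rw [evenKernel, h, mul_assoc 2 π, mul_div_mul_left _ _ two_ne_zero, div_eq_inv_mul]

@[fun_prop]
theorem continuous_korovkinKernel (M : ℕ) : Continuous (korovkinKernel M) := by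
  unfold korovkinKernel
  fun_prop

@[fun_prop]
theorem continuous_evenKernel (M : ℕ) (θ : ℝ) : Continuous (evenKernel M θ) := by
  unfold evenKernel
  fun_prop

/-- Convolution with the Fejér–Korovkin kernel is a finite sum of cosines. -/
theorem integral_evenKernel_mul (M : ℕ) {h : ℝ → ℝ}
    (hh : IntervalIntegrable h volume 0 π) (θ : ℝ) :
    ∫ s in (0:ℝ)..π, evenKernel M θ s * h s =
      (π * korovkinNorm M)⁻¹ * ∑ j ∈ range (M + 1), ∑ k ∈ range (M + 1),
        korovkinCoeff M j * korovkinCoeff M k * cos (((j : ℤ) - (k : ℤ) : ℤ) * θ) *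
          ∫ s in (0:ℝ)..π, cos (((j : ℤ) - (k : ℤ) : ℤ) * s) * h s := by
  have hi (n : ℤ) : IntervalIntegrable (fun s => cos (n * s) * h s) volume 0 π :=
    hh.continuousOn_mul (by fun_prop)
  simp_rw [evenKernel_eq, mul_assoc _ _ (h _), sum_mul]
  rw [intervalIntegral.integral_const_mul, intervalIntegral.integral_finsetSum]
  · congr 1
    refine sum_congr rfl fun j _ => ?_
    rw [intervalIntegral.integral_finsetSum]
    · refine sum_congr rfl fun k _ => ?_
      simp_rw [mul_assoc _ _ (h _)]
      rw [intervalIntegral.integral_const_mul]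
    · intro k _
      simp_rw [mul_assoc _ _ (h _)]
      exact (hi _).const_mul _
  · intro j _
    simp_rw [← sum_mul]
    exact hh.continuousOn_mul (by fun_prop)

theorem continuous_integral_evenKernel_mul (M : ℕ) {h : ℝ → ℝ}
    (hh : IntervalIntegrable h volume 0 π) :
    Continuous fun θ => ∫ s in (0:ℝ)..π, evenKernel M θ s * h s := by
  simp_rw [integral_evenKernel_mul M hh]
  fun_prop

theorem sum_sum_ite_diag (M : ℕ) (c : ℕ → ℕ → ℝ) :
    ∑ j ∈ range (M + 1), ∑ k ∈ range (M + 1),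
      c j k * (if (j : ℤ) - (k : ℤ) = 0 then π else 0) = π * ∑ j ∈ range (M + 1), c j j := by
  rw [mul_sum]
  refine sum_congr rfl fun j hj => ?_
  rw [Finset.sum_eq_single j]
  · simp [mul_comm]
  · intro k _ hk
    rw [if_neg (by omega), mul_zero]
  · exact fun h => absurd hj h

theorem integral_evenKernel (M : ℕ) (θ : ℝ) : ∫ s in (0:ℝ)..π, evenKernel M θ s = 1 := by
  have h := integral_evenKernel_mul M (h := fun _ => 1) (by simp) θ
  simp only [mul_one, integral_cos_int_mul] at h
  rw [h, sum_sum_ite_diag]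
  have hS := (korovkinNorm_pos M).ne'
  simp only [sub_self, Int.cast_zero, zero_mul, cos_zero, mul_one, ← sq]
  rw [← korovkinNorm]
  field_simp

/-- Convolution with the Fejér–Korovkin kernel preserves the mean. -/
theorem integral_integral_evenKernel_mul (M : ℕ) {h : ℝ → ℝ}
    (hh : IntervalIntegrable h volume 0 π) :
    ∫ θ in (0:ℝ)..π, ∫ s in (0:ℝ)..π, evenKernel M θ s * h s = ∫ s in (0:ℝ)..π, h s := by
  simp_rw [integral_evenKernel_mul M hh]
  rw [intervalIntegral.integral_const_mul, intervalIntegral.integral_finsetSum]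
  · have : ∀ j ∈ range (M + 1), (∫ θ in (0:ℝ)..π, ∑ k ∈ range (M + 1),
        korovkinCoeff M j * korovkinCoeff M k * cos (((j : ℤ) - (k : ℤ) : ℤ) * θ) *
          ∫ s in (0:ℝ)..π, cos (((j : ℤ) - (k : ℤ) : ℤ) * s) * h s) =
        ∑ k ∈ range (M + 1), (korovkinCoeff M j * korovkinCoeff M k *
          ∫ s in (0:ℝ)..π, cos (((j : ℤ) - (k : ℤ) : ℤ) * s) * h s) *
            (if (j : ℤ) - (k : ℤ) = 0 then π else 0) := by
      intro j _
      rw [intervalIntegral.integral_finsetSum]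
      · refine sum_congr rfl fun k _ => ?_
        rw [intervalIntegral.integral_mul_const, intervalIntegral.integral_const_mul,
          integral_cos_int_mul]
        ring
      · intro k _
        exact Continuous.intervalIntegrable (by fun_prop) _ _
    rw [sum_congr rfl this, sum_sum_ite_diag]
    have hS := (korovkinNorm_pos M).ne'
    simp only [sub_self, Int.cast_zero, zero_mul, cos_zero, one_mul, ← sq, ← sum_mul]
    rw [← korovkinNorm]
    field_simp
  · intro j _
    exact Continuous.intervalIntegrable (by fun_prop) _ _

theorem sum_korovkinCoeff_mul_succ (M : ℕ) :
    ∑ j ∈ range (M + 1), korovkinCoeff M j * korovkinCoeff M (j + 1) =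
      cos (π / (M + 2)) * korovkinNorm M := by
  set ω := π / (M + 2) with hω
  have htel := Finset.sum_range_sub (fun j : ℕ => sin (ω * j) * sin (ω * (j + 1))) (M + 1)
  have hend : sin (ω * ((M + 1 : ℕ) + 1)) = 0 := by
    rw [show ω * ((M + 1 : ℕ) + 1) = π by push_cast; rw [hω]; field_simp; ring, sin_pi]
  rw [hend] at htel
  have key (j : ℕ) : 2 * (korovkinCoeff M j * korovkinCoeff M (j + 1)) =
      2 * cos ω * korovkinCoeff M j ^ 2 +
      (sin (ω * (j + 1 : ℕ)) * sin (ω * ((j + 1 : ℕ) + 1)) -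
        sin (ω * j) * sin (ω * (j + 1))) := by
    simp only [korovkinCoeff, ← hω]
    push_cast
    have e1 : sin (ω * (j + 1 + 1)) = sin (ω * (j + 1)) * cos ω + cos (ω * (j + 1)) * sin ω := by
      rw [← sin_add]; ring_nf
    have e2 : sin (ω * j) = sin (ω * (j + 1)) * cos ω - cos (ω * (j + 1)) * sin ω := by
      rw [← sin_sub]; ring_nf
    rw [e1, e2]
    ring
  have hsum := sum_congr (rfl : range (M + 1) = range (M + 1)) fun j _ => key j
  rw [sum_add_distrib, htel, ← mul_sum, ← mul_sum, ← korovkinNorm] at hsum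
  simp only [Nat.cast_zero, mul_zero, zero_mul, sin_zero, sub_self, add_zero] at hsum
  linarith

theorem korovkinCoeff_succ_self (M : ℕ) : korovkinCoeff M (M + 1) = 0 := by
  rw [korovkinCoeff, show π / (M + 2) * ((M + 1 : ℕ) + 1) = π by push_cast; field_simp; ring,
    sin_pi]

theorem sum_sum_ite_offdiag (M : ℕ) :
    ∑ j ∈ range (M + 1), ∑ k ∈ range (M + 1), korovkinCoeff M j * korovkinCoeff M k *
      (if (j : ℤ) - (k : ℤ) + 1 = 0 then π else 0) = π * (cos (π / (M + 2)) * korovkinNorm M) := by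
  rw [← sum_korovkinCoeff_mul_succ, mul_sum]
  refine sum_congr rfl fun j hj => ?_
  rw [Finset.sum_eq_single (j + 1)]
  · simp [mul_comm]
  · intro k _ hk
    rw [if_neg (by omega), mul_zero]
  · intro h
    have : j = M := by simp at h hj; omega
    rw [this, korovkinCoeff_succ_self]
    simp

theorem korovkinKernel_mul_cos_add (M : ℕ) (θ s : ℝ) :
    korovkinKernel M (θ - s) * cos (θ - s) + korovkinKernel M (θ + s) * cos (θ + s) =
      ∑ j ∈ range (M + 1), ∑ k ∈ range (M + 1), korovkinCoeff M j * korovkinCoeff M k *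
        (cos (((j : ℤ) - (k : ℤ) + 1 : ℤ) * θ) * cos (((j : ℤ) - (k : ℤ) + 1 : ℤ) * s) +
         cos (((k : ℤ) - (j : ℤ) + 1 : ℤ) * θ) * cos (((k : ℤ) - (j : ℤ) + 1 : ℤ) * s)) := by
  rw [korovkinKernel, korovkinKernel, sum_mul, sum_mul, ← sum_add_distrib]
  refine sum_congr rfl fun j _ => ?_
  rw [sum_mul, sum_mul, ← sum_add_distrib]
  refine sum_congr rfl fun k _ => ?_
  have e (x : ℝ) (d : ℝ) : cos (d * x) * cos x = (cos ((d + 1) * x) + cos ((-d + 1) * x)) / 2 := by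
    rw [add_mul, add_mul, cos_add, cos_add, neg_mul, cos_neg, sin_neg, one_mul]
    ring
  have f (d : ℝ) : cos (d * (θ - s)) + cos (d * (θ + s)) = 2 * (cos (d * θ) * cos (d * s)) := by
    rw [mul_sub, mul_add, cos_sub, cos_add]
    ring
  push_cast
  rw [mul_assoc _ _ (cos (θ - s)), mul_assoc _ _ (cos (θ + s)), e, e]
  have h1 := f ((j : ℝ) - k + 1)
  have h2 := f (-((j : ℝ) - k) + 1)
  rw [show (k : ℝ) - j + 1 = -((j : ℝ) - k) + 1 by ring]
  linear_combination korovkinCoeff M j * korovkinCoeff M k / 2 * (h1 + h2)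

theorem integral_korovkinKernel_mul_cos (M : ℕ) (θ : ℝ) :
    ∫ s in (0:ℝ)..π, (korovkinKernel M (θ - s) * cos (θ - s) +
      korovkinKernel M (θ + s) * cos (θ + s)) =
      2 * π * korovkinNorm M * cos (π / (M + 2)) := by
  have e (n : ℤ) : cos (n * θ) * (if n = 0 then π else 0) = if n = 0 then π else 0 := by
    split_ifs with h <;> simp [h]
  simp_rw [korovkinKernel_mul_cos_add]
  rw [intervalIntegral.integral_finsetSum]
  · have : ∀ j ∈ range (M + 1), (∫ s in (0:ℝ)..π, ∑ k ∈ range (M + 1),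
        korovkinCoeff M j * korovkinCoeff M k *
        (cos (((j : ℤ) - (k : ℤ) + 1 : ℤ) * θ) * cos (((j : ℤ) - (k : ℤ) + 1 : ℤ) * s) +
         cos (((k : ℤ) - (j : ℤ) + 1 : ℤ) * θ) * cos (((k : ℤ) - (j : ℤ) + 1 : ℤ) * s))) =
        ∑ k ∈ range (M + 1), (korovkinCoeff M j * korovkinCoeff M k *
          (if (j : ℤ) - (k : ℤ) + 1 = 0 then π else 0) +
          korovkinCoeff M k * korovkinCoeff M j *
          (if (k : ℤ) - (j : ℤ) + 1 = 0 then π else 0)) := by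
      intro j _
      rw [intervalIntegral.integral_finsetSum]
      · refine sum_congr rfl fun k _ => ?_
        rw [intervalIntegral.integral_const_mul, intervalIntegral.integral_add,
          intervalIntegral.integral_const_mul, intervalIntegral.integral_const_mul,
          integral_cos_int_mul, integral_cos_int_mul, e, e]
        · ring
        all_goals exact Continuous.intervalIntegrable (by fun_prop) _ _
      · intro k _
        exact Continuous.intervalIntegrable (by fun_prop) _ _
    rw [sum_congr rfl this]
    simp_rw [sum_add_distrib]
    rw [sum_comm (f := fun j k => korovkinCoeff M k * korovkinCoeff M j *
          (if (k : ℤ) - (j : ℤ) + 1 = 0 then π else 0)), sum_sum_ite_offdiag]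
    ring
  · intro j _
    exact Continuous.intervalIntegrable (by fun_prop) _ _

/-- The even Fejér–Korovkin kernel is concentrated near the diagonal. -/
theorem integral_evenKernel_mul_one_sub_cos_le (M : ℕ) {θ : ℝ} (hθ : θ ∈ Set.Icc 0 π) :
    ∫ s in (0:ℝ)..π, evenKernel M θ s * (1 - cos (θ - s)) ≤ 1 - cos (π / (M + 2)) := by
  have hS := korovkinNorm_pos M
  have hpos : 0 < 2 * π * korovkinNorm M := by positivity
  calc ∫ s in (0:ℝ)..π, evenKernel M θ s * (1 - cos (θ - s))
      ≤ ∫ s in (0:ℝ)..π, (evenKernel M θ s - (2 * π * korovkinNorm M)⁻¹ *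
          (korovkinKernel M (θ - s) * cos (θ - s) + korovkinKernel M (θ + s) * cos (θ + s))) := by
        refine intervalIntegral.integral_mono_on pi_pos.le
          (Continuous.intervalIntegrable (by fun_prop) _ _)
          (Continuous.intervalIntegrable (by fun_prop) _ _) fun s hs => ?_
        have hc : cos (θ + s) ≤ cos (θ - s) := by
          rw [cos_add, cos_sub]
          have := mul_nonneg (sin_nonneg_of_mem_Icc hθ) (sin_nonneg_of_mem_Icc hs)
          linarith
        have h := mul_le_mul_of_nonneg_left
          (mul_le_mul_of_nonneg_left hc (korovkinKernel_nonneg M (θ + s))) (inv_pos.2 hpos).le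
        rw [evenKernel, div_eq_inv_mul]
        linarith
    _ = 1 - cos (π / (M + 2)) := by
        rw [intervalIntegral.integral_sub (Continuous.intervalIntegrable (by fun_prop) _ _)
          (Continuous.intervalIntegrable (by fun_prop) _ _), integral_evenKernel,
          intervalIntegral.integral_const_mul, integral_korovkinKernel_mul_cos]
        field_simp

/-- A bump of width about `√δ` around `c`. -/
noncomputable def cosBump (δ c s : ℝ) : ℝ := δ / (δ + 1 - cos (s - c))

theorem cosBump_denom_pos {δ : ℝ} (hδ : 0 < δ) (c s : ℝ) : 0 < δ + 1 - cos (s - c) := by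
  linarith [cos_le_one (s - c)]

theorem cosBump_nonneg {δ : ℝ} (hδ : 0 < δ) (c s : ℝ) : 0 ≤ cosBump δ c s :=
  (div_pos hδ (cosBump_denom_pos hδ c s)).le

theorem continuous_cosBump {δ : ℝ} (hδ : 0 < δ) (c : ℝ) : Continuous (cosBump δ c) := by
  unfold cosBump
  exact Continuous.div (by fun_prop) (by fun_prop) fun s => (cosBump_denom_pos hδ c s).ne'

theorem one_sub_cos_sub_le (s θ c : ℝ) :
    1 - cos (s - c) ≤ 2 * (1 - cos (θ - s)) + 2 * (1 - cos (θ - c)) := by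
  have e (x : ℝ) : 1 - cos x = 2 * sin (x / 2) ^ 2 := by
    rw [sin_sq_eq_half_sub, mul_div_cancel₀ _ two_ne_zero]; ring
  have h : sin ((s - c) / 2) =
      sin ((θ - c) / 2) * cos ((θ - s) / 2) - cos ((θ - c) / 2) * sin ((θ - s) / 2) := by
    rw [← sin_sub]; ring_nf
  rw [e, e, e, h]
  set p := sin ((θ - c) / 2)
  set q := sin ((θ - s) / 2)
  have h1 : (p * cos ((θ - s) / 2)) ^ 2 ≤ p ^ 2 := by
    rw [mul_pow]; exact mul_le_of_le_one_right (sq_nonneg _) (cos_sq_le_one _)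
  have h2 : (cos ((θ - c) / 2) * q) ^ 2 ≤ q ^ 2 := by
    rw [mul_pow]; exact mul_le_of_le_one_left (sq_nonneg _) (cos_sq_le_one _)
  nlinarith [sq_nonneg (p * cos ((θ - s) / 2) + cos ((θ - c) / 2) * q)]

/-- Six times the bump dominates, up to an affine function of `1 - cos (θ - s)` whose
average is nonnegative, the quotient bounding the jump of an indicator across `c`. -/
theorem exists_affine_le_cosBump {δ : ℝ} (hδ : 0 < δ) (θ c : ℝ) :
    ∃ A B : ℝ, 0 ≤ B ∧ B * δ ≤ A ∧ ∀ s, A - B * (1 - cos (θ - s)) ≤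
      6 * cosBump δ c s - (δ + (1 - cos (θ - s))) / (δ + (1 - cos (θ - c))) := by
  set D := 1 - cos (θ - c) with hD
  have hD0 : 0 ≤ D := by linarith [cos_le_one (θ - c)]
  set z := δ + D with hz
  have hz0 : 0 < z := by positivity
  refine ⟨6 * δ * (2 / (3 * z) - (δ + 2 * D) / (3 * z) ^ 2) - δ / z,
    12 * δ / (3 * z) ^ 2 + 1 / z, by positivity, ?_, fun s => ?_⟩
  · rw [← sub_nonneg]
    have : 6 * δ * (2 / (3 * z) - (δ + 2 * D) / (3 * z) ^ 2) - δ / z -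
        (12 * δ / (3 * z) ^ 2 + 1 / z) * δ = 2 * δ * (3 * z - 3 * δ - 2 * D) / (3 * z ^ 2) := by
      field_simp
      ring
    rw [this, hz]
    ring_nf
    positivity
  · set q := 1 - cos (θ - s) with hq
    set y := δ + 1 - cos (s - c) with hy
    have hy0 : 0 < y := cosBump_denom_pos hδ c s
    have hyle : y ≤ δ + 2 * q + 2 * D := by
      have := one_sub_cos_sub_le s θ c
      linarith
    have htan : 2 / (3 * z) - y / (3 * z) ^ 2 ≤ 1 / y := by
      rw [← sub_nonneg]
      have : 1 / y - (2 / (3 * z) - y / (3 * z) ^ 2) = (3 * z - y) ^ 2 / (y * (3 * z) ^ 2) := by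
        field_simp
        ring
      rw [this]
      positivity
    have h2 : y / (3 * z) ^ 2 ≤ (δ + 2 * q + 2 * D) / (3 * z) ^ 2 := by gcongr
    have h3 : δ * (2 / (3 * z) - (δ + 2 * q + 2 * D) / (3 * z) ^ 2) ≤ δ * (1 / y) :=
      mul_le_mul_of_nonneg_left (by linarith) hδ.le
    have h4 : cosBump δ c s = δ * (1 / y) := by rw [cosBump, mul_one_div]
    rw [h4]
    have h5 : 6 * δ * (2 / (3 * z) - (δ + 2 * D) / (3 * z) ^ 2) - δ / z -
        (12 * δ / (3 * z) ^ 2 + 1 / z) * q =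
        6 * (δ * (2 / (3 * z) - (δ + 2 * q + 2 * D) / (3 * z) ^ 2)) - (δ + q) / z := by
      field_simp
      ring
    linarith

theorem one_le_quotient_of_between {δ θ s c : ℝ} (hδ : 0 < δ) (hθ : θ ∈ Set.Icc 0 π)
    (hs : s ∈ Set.Icc 0 π) (h : (θ ≤ c ∧ c ≤ s) ∨ (s ≤ c ∧ c ≤ θ)) :
    1 ≤ (δ + (1 - cos (θ - s))) / (δ + (1 - cos (θ - c))) := by
  have hpos : 0 < δ + (1 - cos (θ - c)) := by linarith [cos_le_one (θ - c)]
  rw [one_le_div hpos]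
  have : cos (θ - s) ≤ cos (θ - c) := by
    rcases h with ⟨h1, h2⟩ | ⟨h1, h2⟩
    · rw [← cos_neg (θ - s), ← cos_neg (θ - c)]
      exact cos_le_cos_of_nonneg_of_le_pi (by linarith) (by linarith [hs.2, hθ.1]) (by linarith)
    · exact cos_le_cos_of_nonneg_of_le_pi (by linarith) (by linarith [hs.1, hθ.2]) (by linarith)
  linarith

theorem abs_indicator_sub_indicator_le {δ θ s a b : ℝ} (hδ : 0 < δ) (hθ : θ ∈ Set.Icc 0 π)
    (hs : s ∈ Set.Icc 0 π) :
    |(Set.Icc a b).indicator (fun _ => (1:ℝ)) s - (Set.Icc a b).indicator (fun _ => (1:ℝ)) θ| ≤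
      (δ + (1 - cos (θ - s))) / (δ + (1 - cos (θ - a))) +
        (δ + (1 - cos (θ - s))) / (δ + (1 - cos (θ - b))) := by
  have hq (c : ℝ) : 0 ≤ (δ + (1 - cos (θ - s))) / (δ + (1 - cos (θ - c))) :=
    div_nonneg (by linarith [cos_le_one (θ - s)]) (by linarith [cos_le_one (θ - c)])
  have ha := hq a
  have hb := hq b
  have hbet {c : ℝ} := one_le_quotient_of_between (c := c) hδ hθ hs
  by_cases h1 : s ∈ Set.Icc a b <;> by_cases h2 : θ ∈ Set.Icc a b
  · simp only [Set.indicator_of_mem h1, Set.indicator_of_mem h2, sub_self, abs_zero]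
    positivity
  · simp only [Set.indicator_of_mem h1, Set.indicator_of_notMem h2, sub_zero, abs_one]
    by_cases h : θ < a
    · linarith [hbet (c := a) (Or.inl ⟨h.le, h1.1⟩)]
    · have h' : b < θ := by
        by_contra! hc
        exact h2 ⟨not_lt.1 h, hc⟩
      linarith [hbet (c := b) (Or.inr ⟨h1.2, h'.le⟩)]
  · simp only [Set.indicator_of_notMem h1, Set.indicator_of_mem h2, zero_sub, abs_neg, abs_one]
    by_cases h : s < a
    · linarith [hbet (c := a) (Or.inr ⟨h.le, h2.1⟩)]
    · have h' : b < s := by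
        by_contra! hc
        exact h1 ⟨not_lt.1 h, hc⟩
      linarith [hbet (c := b) (Or.inl ⟨h2.2, h'.le⟩)]
  · simp only [Set.indicator_of_notMem h1, Set.indicator_of_notMem h2, sub_self, abs_zero]
    positivity

theorem intervalIntegrable_indicator_Icc (a b x y : ℝ) :
    IntervalIntegrable ((Set.Icc a b).indicator fun _ => (1:ℝ)) volume x y :=
  (IntegrableOn.integrable_indicator (by simp) measurableSet_Icc).intervalIntegrable

/-- The error of smoothing the indicator of `[a, b]` is at most the smoothed sum of bumps at `a`
and `b`. -/
theorem abs_integral_evenKernel_mul_indicator_sub_le (M : ℕ) {δ θ a b : ℝ} (hδ : 0 < δ)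
    (hδM : δ = 1 - cos (π / (M + 2))) (hθ : θ ∈ Set.Icc 0 π) :
    |(∫ s in (0:ℝ)..π, evenKernel M θ s * (Set.Icc a b).indicator (fun _ => (1:ℝ)) s) -
      (Set.Icc a b).indicator (fun _ => (1:ℝ)) θ| ≤
      ∫ s in (0:ℝ)..π, evenKernel M θ s * (6 * cosBump δ a s + 6 * cosBump δ b s) := by
  set χ := (Set.Icc a b).indicator (fun _ => (1:ℝ)) with hχ
  have hχi : IntervalIntegrable χ volume 0 π := intervalIntegrable_indicator_Icc a b 0 π
  have hWχ : IntervalIntegrable (fun s => evenKernel M θ s * χ s) volume 0 π :=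
    hχi.continuousOn_mul (by fun_prop)
  have hca := continuous_cosBump hδ a
  have hcb := continuous_cosBump hδ b
  obtain ⟨A, B, hB, hAB, hA⟩ := exists_affine_le_cosBump hδ θ a
  obtain ⟨A', B', hB', hAB', hA'⟩ := exists_affine_le_cosBump hδ θ b
  have e1 : (∫ s in (0:ℝ)..π, evenKernel M θ s * χ s) - χ θ =
      ∫ s in (0:ℝ)..π, (evenKernel M θ s * χ s - evenKernel M θ s * χ θ) := by
    rw [intervalIntegral.integral_sub hWχ (Continuous.intervalIntegrable (by fun_prop) _ _),
      intervalIntegral.integral_mul_const, integral_evenKernel, one_mul]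
  have hmean : 0 ≤ ∫ s in (0:ℝ)..π, (evenKernel M θ s * (A + A') -
      (B + B') * (evenKernel M θ s * (1 - cos (θ - s)))) := by
    rw [intervalIntegral.integral_sub (Continuous.intervalIntegrable (by fun_prop) _ _)
      (Continuous.intervalIntegrable (by fun_prop) _ _), intervalIntegral.integral_mul_const,
      integral_evenKernel, intervalIntegral.integral_const_mul]
    have h := integral_evenKernel_mul_one_sub_cos_le M hθ
    rw [← hδM] at h
    have := mul_le_mul_of_nonneg_left h (add_nonneg hB hB')
    linarith
  rw [e1]
  calc |∫ s in (0:ℝ)..π, (evenKernel M θ s * χ s - evenKernel M θ s * χ θ)|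
      ≤ ∫ s in (0:ℝ)..π, |evenKernel M θ s * χ s - evenKernel M θ s * χ θ| :=
        intervalIntegral.abs_integral_le_integral_abs pi_pos.le
    _ ≤ ∫ s in (0:ℝ)..π, (evenKernel M θ s * (6 * cosBump δ a s + 6 * cosBump δ b s) -
          (evenKernel M θ s * (A + A') -
            (B + B') * (evenKernel M θ s * (1 - cos (θ - s))))) := by
        refine intervalIntegral.integral_mono_on pi_pos.le
          (hWχ.sub (Continuous.intervalIntegrable (by fun_prop) _ _)).abs
          (Continuous.intervalIntegrable (by fun_prop) _ _) fun s hs => ?_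
        have hw := evenKernel_nonneg M θ s
        rw [← mul_sub, abs_mul, abs_of_nonneg hw]
        have h := abs_indicator_sub_indicator_le (a := a) (b := b) hδ hθ hs
        rw [← hχ] at h
        have h' := mul_le_mul_of_nonneg_left
          (h.trans (by linarith [hA s, hA' s] :
            _ ≤ 6 * cosBump δ a s + 6 * cosBump δ b s -
              (A + A' - (B + B') * (1 - cos (θ - s))))) hw
        linarith
    _ ≤ _ := by
        rw [intervalIntegral.integral_sub (Continuous.intervalIntegrable (by fun_prop) _ _)
          (Continuous.intervalIntegrable (by fun_prop) _ _)]
        linarith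

theorem integral_cosBump_le {δ ω c : ℝ} (hδ : 0 < δ) (hω : 0 < ω) (hδω : δ ≤ ω ^ 2 / 2)
    (hc : c ∈ Set.Icc 0 π) : ∫ s in (0:ℝ)..π, cosBump δ c s ≤ π ^ 2 / 2 * ω := by
  set r := 2 / (π * ω) with hr
  have hr0 : r ≠ 0 := by positivity
  calc ∫ s in (0:ℝ)..π, cosBump δ c s
      ≤ ∫ s in (0:ℝ)..π, (1 + (r * s - r * c) ^ 2)⁻¹ := by
        refine intervalIntegral.integral_mono_on pi_pos.le
          ((continuous_cosBump hδ c).intervalIntegrable _ _)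
          (Continuous.intervalIntegrable ?_ _ _) fun s hs => ?_
        · exact Continuous.inv₀ (by fun_prop) fun s => by positivity
        · have hq := cos_le_one_sub_mul_cos_sq (x := s - c)
            (abs_le.2 ⟨by linarith [hs.1, hc.2], by linarith [hs.2, hc.1]⟩)
          have hpos := cosBump_denom_pos hδ c s
          rw [cosBump, ← one_div, div_le_div_iff₀ hpos (by positivity), one_mul]
          have hrs : ω ^ 2 / 2 * (r * s - r * c) ^ 2 = 2 / π ^ 2 * (s - c) ^ 2 := by
            rw [← mul_sub, hr]
            field_simp
          nlinarith [mul_le_mul_of_nonneg_right hδω (sq_nonneg (r * s - r * c))]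
    _ = r⁻¹ * (arctan (r * π - r * c) - arctan (r * 0 - r * c)) := by
        rw [intervalIntegral.integral_comp_mul_sub (fun x => (1 + x ^ 2)⁻¹) hr0,
          integral_inv_one_add_sq, smul_eq_mul]
    _ ≤ r⁻¹ * π := by
        have := arctan_lt_pi_div_two (r * π - r * c)
        have := neg_pi_div_two_lt_arctan (r * 0 - r * c)
        exact mul_le_mul_of_nonneg_left (by linarith) (by positivity)
    _ = π ^ 2 / 2 * ω := by
        rw [hr]
        field_simp

/-- The space of combinations of `θ ↦ U_m (cos θ)` with `m ≤ M`. -/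
def chebyshevSpan (M : ℕ) : Submodule ℝ (ℝ → ℝ) :=
  Submodule.span ℝ ((fun (m : ℕ) (θ : ℝ) => (Chebyshev.U ℝ m).eval (cos θ)) '' range (M + 1))

theorem eval_U_mem_chebyshevSpan {M m : ℕ} (h : m ≤ M) :
    (fun θ : ℝ => (Chebyshev.U ℝ m).eval (cos θ)) ∈ chebyshevSpan M :=
  Submodule.subset_span ⟨m, by simpa using Nat.lt_succ_of_le h, rfl⟩

theorem cos_nat_mul_mem_chebyshevSpan {M n : ℕ} (h : n ≤ M) :
    (fun θ : ℝ => cos (n * θ)) ∈ chebyshevSpan M := by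
  match n with
  | 0 => simpa using eval_U_mem_chebyshevSpan h
  | 1 =>
    convert (chebyshevSpan M).smul_mem (1 / 2) (eval_U_mem_chebyshevSpan h) using 1
    ext θ
    simp
  | n + 2 =>
    convert (chebyshevSpan M).smul_mem (1 / 2) ((chebyshevSpan M).sub_mem
      (eval_U_mem_chebyshevSpan h) (eval_U_mem_chebyshevSpan (m := n) (by omega))) using 1
    ext θ
    have h1 := congrArg (Polynomial.eval (cos θ)) (Chebyshev.two_mul_T_eq_U_sub_U ℝ n)
    have h2 := Chebyshev.T_real_cos θ (n + 2)
    rw [eval_mul, h2] at h1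
    simp only [eval_ofNat, eval_sub] at h1
    simp only [Pi.smul_apply, Pi.sub_apply, smul_eq_mul]
    push_cast at h1 ⊢
    linarith

theorem cos_int_mul_mem_chebyshevSpan {M : ℕ} {n : ℤ} (h : n.natAbs ≤ M) :
    (fun θ : ℝ => cos (n * θ)) ∈ chebyshevSpan M := by
  convert cos_nat_mul_mem_chebyshevSpan h using 2 with θ
  rcases Int.natAbs_eq n with hn | hn <;> rw [hn] <;> simp

theorem integral_evenKernel_mul_mem_chebyshevSpan (M : ℕ) {h : ℝ → ℝ}
    (hh : IntervalIntegrable h volume 0 π) :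
    (fun θ => ∫ s in (0:ℝ)..π, evenKernel M θ s * h s) ∈ chebyshevSpan M := by
  have : (fun θ => ∫ s in (0:ℝ)..π, evenKernel M θ s * h s) =
      (π * korovkinNorm M)⁻¹ • ∑ j ∈ range (M + 1), ∑ k ∈ range (M + 1),
        (korovkinCoeff M j * korovkinCoeff M k *
          ∫ s in (0:ℝ)..π, cos (((j : ℤ) - (k : ℤ) : ℤ) * s) * h s) •
        (fun θ : ℝ => cos (((j : ℤ) - (k : ℤ) : ℤ) * θ)) := by
    ext θ
    rw [integral_evenKernel_mul M hh]
    simp only [Pi.smul_apply, Finset.sum_apply, smul_eq_mul]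
    congr 1
    exact sum_congr rfl fun j _ => sum_congr rfl fun k _ => by ring
  rw [this]
  refine Submodule.smul_mem _ _ (Submodule.sum_mem _ fun j hj => Submodule.sum_mem _ fun k hk =>
    Submodule.smul_mem _ _ (cos_int_mul_mem_chebyshevSpan ?_))
  simp only [mem_range] at hj hk
  omega

theorem integral_eval_U_mul_eval_U_mul_sin_sq (m n : ℕ) :
    ∫ θ in (0:ℝ)..π, (Chebyshev.U ℝ m).eval (cos θ) * ((Chebyshev.U ℝ n).eval (cos θ) *
      sin θ ^ 2) = if m = n then π / 2 else 0 := by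
  have h (θ : ℝ) : (Chebyshev.U ℝ m).eval (cos θ) * ((Chebyshev.U ℝ n).eval (cos θ) *
      sin θ ^ 2) = (cos (((m : ℤ) - n : ℤ) * θ) - cos (((m : ℤ) + n + 2 : ℤ) * θ)) / 2 := by
    have h1 := Chebyshev.U_real_cos θ m
    have h2 := Chebyshev.U_real_cos θ n
    push_cast at h1 h2 ⊢
    have e1 : cos (((m : ℝ) - n) * θ) = cos ((m + 1) * θ - (n + 1) * θ) := by ring_nf
    have e2 : cos (((m : ℝ) + n + 2) * θ) = cos ((m + 1) * θ + (n + 1) * θ) := by ring_nf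
    rw [e1, e2, cos_sub, cos_add, ← h1, ← h2]
    ring
  simp_rw [h]
  rw [intervalIntegral.integral_div, intervalIntegral.integral_sub
    (Continuous.intervalIntegrable (by fun_prop) _ _)
    (Continuous.intervalIntegrable (by fun_prop) _ _), integral_cos_int_mul, integral_cos_int_mul,
    if_neg (by omega : ¬((m : ℤ) + n + 2 = 0))]
  by_cases hmn : m = n
  · simp [hmn]
  · rw [if_neg (by omega), if_neg hmn]
    simp

theorem integral_sum_mul_eval_U_mul_sin_sq {M m : ℕ} (f : ℕ → ℝ) (hm : m ≤ M) :
    ∫ θ in (0:ℝ)..π, (∑ n ∈ range (M + 1), f n * (Chebyshev.U ℝ n).eval (cos θ)) *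
      ((Chebyshev.U ℝ m).eval (cos θ) * sin θ ^ 2) = f m * (π / 2) := by
  simp_rw [sum_mul, mul_assoc (f _)]
  rw [intervalIntegral.integral_finsetSum fun n _ =>
    Continuous.intervalIntegrable (by fun_prop) _ _]
  simp_rw [intervalIntegral.integral_const_mul, integral_eval_U_mul_eval_U_mul_sin_sq]
  rw [Finset.sum_eq_single m (fun n _ hn => by simp [hn])
    (fun h => absurd (by simpa using Nat.lt_succ_of_le hm) h), if_pos rfl]

theorem abs_eval_U_mul_sin_sq_le_one (m : ℕ) (θ : ℝ) :
    |(Chebyshev.U ℝ m).eval (cos θ) * sin θ ^ 2| ≤ 1 := by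
  rw [sq, ← mul_assoc, Chebyshev.U_real_cos, abs_mul]
  exact mul_le_one₀ (abs_sin_le_one _) (abs_nonneg _) (abs_sin_le_one _)

theorem integral_indicator_Icc_mul {a b : ℝ} (ha : 0 ≤ a) (hab : a ≤ b) (hb : b ≤ π)
    (φ : ℝ → ℝ) :
    ∫ θ in (0:ℝ)..π, (Set.Icc a b).indicator (fun _ => (1:ℝ)) θ * φ θ = ∫ θ in a..b, φ θ := by
  have h : (fun θ => (Set.Icc a b).indicator (fun _ => (1:ℝ)) θ * φ θ) =
      (Set.Icc a b).indicator φ := by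
    ext θ
    by_cases hθ : θ ∈ Set.Icc a b <;> simp [hθ]
  rw [h, integral_of_le pi_pos.le, integral_of_le hab, ← integral_Icc_eq_integral_Ioc,
    ← integral_Icc_eq_integral_Ioc, setIntegral_indicator measurableSet_Icc,
    Set.inter_eq_self_of_subset_right (Set.Icc_subset_Icc ha hb)]

theorem abs_coeff_sub_le {a b : ℝ} (ha : 0 ≤ a) (hab : a ≤ b) (hb : b ≤ π) {M m : ℕ}
    (hm : m ≤ M) (f : ℕ → ℝ) :
    |f m - 2 / π * ∫ θ in a..b, (Chebyshev.U ℝ m).eval (cos θ) * sin θ ^ 2| ≤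
      2 / π * ∫ θ in (0:ℝ)..π, |(∑ n ∈ range (M + 1), f n * (Chebyshev.U ℝ n).eval (cos θ)) -
        (Set.Icc a b).indicator (fun _ => (1:ℝ)) θ| := by
  set χ := (Set.Icc a b).indicator (fun _ => (1:ℝ))
  have hχ : IntervalIntegrable χ volume 0 π := intervalIntegrable_indicator_Icc a b 0 π
  have hF : IntervalIntegrable
      (fun θ => (∑ n ∈ range (M + 1), f n * (Chebyshev.U ℝ n).eval (cos θ)) - χ θ) volume 0 π :=
    (Continuous.intervalIntegrable (by fun_prop) _ _).sub hχ
  have h : f m - 2 / π * ∫ θ in a..b, (Chebyshev.U ℝ m).eval (cos θ) * sin θ ^ 2 =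
      2 / π * ∫ θ in (0:ℝ)..π, ((∑ n ∈ range (M + 1), f n * (Chebyshev.U ℝ n).eval (cos θ)) -
        χ θ) * ((Chebyshev.U ℝ m).eval (cos θ) * sin θ ^ 2) := by
    simp_rw [sub_mul]
    rw [intervalIntegral.integral_sub (Continuous.intervalIntegrable (by fun_prop) _ _)
      (hχ.mul_continuousOn (by fun_prop)), integral_sum_mul_eval_U_mul_sin_sq f hm,
      integral_indicator_Icc_mul ha hab hb]
    field_simp
  rw [h, abs_mul, abs_of_pos (by positivity : 0 < 2 / π)]
  refine mul_le_mul_of_nonneg_left ?_ (by positivity)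
  refine (intervalIntegral.abs_integral_le_integral_abs pi_pos.le).trans ?_
  refine intervalIntegral.integral_mono_on pi_pos.le
    (hF.mul_continuousOn (by fun_prop)).abs hF.abs fun θ _ => ?_
  rw [abs_mul]
  exact mul_le_of_le_one_right (abs_nonneg _) (abs_eval_U_mul_sin_sq_le_one m θ)

/-- One-sided approximation of an indicator: `σ = 1` gives a majorant, `σ = -1` a minorant. -/
theorem exists_one_sided_approximation {a b : ℝ} (ha : 0 ≤ a) (hab : a ≤ b) (hb : b ≤ π) (M : ℕ)
    {σ : ℝ} (hσ : σ = 1 ∨ σ = -1) :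
    ∃ f : ℕ → ℝ, (∀ θ ∈ Set.Icc (0:ℝ) π,
        0 ≤ σ * ((∑ m ∈ range (M + 1), f m * (Chebyshev.U ℝ m).eval (cos θ)) -
          (Set.Icc a b).indicator (fun _ => (1:ℝ)) θ)) ∧
      ∀ m ≤ M, |f m - 2 / π * ∫ θ in a..b, (Chebyshev.U ℝ m).eval (cos θ) * sin θ ^ 2| ≤
        12 * π ^ 2 / (M + 1) := by
  set χ := (Set.Icc a b).indicator (fun _ => (1:ℝ)) with hχ
  set ω := π / (M + 2) with hω
  have hω0 : 0 < ω := by positivity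
  have hωπ : ω < π := div_lt_self pi_pos (by linarith [(Nat.cast_nonneg M : (0:ℝ) ≤ M)])
  obtain ⟨δ, hδ⟩ : ∃ δ, δ = 1 - cos ω := ⟨_, rfl⟩
  have hδ0 : 0 < δ := by
    have := cos_lt_cos_of_nonneg_of_le_pi le_rfl hωπ.le hω0
    rw [cos_zero] at this
    linarith
  have hδω : δ ≤ ω ^ 2 / 2 := by linarith [one_sub_sq_div_two_le_cos (x := ω)]
  have hσσ : σ * σ = 1 := by rcases hσ with rfl | rfl <;> norm_num
  have hσabs : |σ| = 1 := by rcases hσ with rfl | rfl <;> norm_num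
  have hχi : IntervalIntegrable χ volume 0 π := intervalIntegrable_indicator_Icc a b 0 π
  have hca := continuous_cosBump hδ0 a
  have hcb := continuous_cosBump hδ0 b
  set G : ℝ → ℝ := fun s => 6 * cosBump δ a s + 6 * cosBump δ b s with hG
  have hGc : Continuous G := by fun_prop
  have hGi : IntervalIntegrable G volume 0 π := hGc.intervalIntegrable _ _
  have hσGi : IntervalIntegrable (fun s => σ * G s) volume 0 π := hGi.const_mul σ
  have hhi : IntervalIntegrable (fun s => χ s + σ * G s) volume 0 π := hχi.add hσGi
  have hmem := integral_evenKernel_mul_mem_chebyshevSpan M hhi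
  rw [chebyshevSpan, Submodule.mem_span_image_finset_iff_exists_fun'] at hmem
  obtain ⟨f, hf⟩ := hmem
  have hF (θ : ℝ) : ∑ m ∈ range (M + 1), f m * (Chebyshev.U ℝ m).eval (cos θ) =
      ∫ s in (0:ℝ)..π, evenKernel M θ s * (χ s + σ * G s) := by
    rw [← congrFun hf θ]
    simp
  have hone : ∀ θ ∈ Set.Icc (0:ℝ) π,
      0 ≤ σ * ((∑ m ∈ range (M + 1), f m * (Chebyshev.U ℝ m).eval (cos θ)) - χ θ) := by
    intro θ hθ
    have h := abs_integral_evenKernel_mul_indicator_sub_le M (a := a) (b := b) hδ0 hδ hθ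
    rw [← hχ] at h
    have e : ∫ s in (0:ℝ)..π, evenKernel M θ s * (χ s + σ * G s) =
        (∫ s in (0:ℝ)..π, evenKernel M θ s * χ s) +
          σ * ∫ s in (0:ℝ)..π, evenKernel M θ s * G s := by
      simp_rw [mul_add, mul_left_comm _ σ]
      rw [intervalIntegral.integral_add (hχi.continuousOn_mul (by fun_prop))
        (Continuous.intervalIntegrable (by fun_prop) _ _), intervalIntegral.integral_const_mul]
    rw [hF, e]
    set I := ∫ s in (0:ℝ)..π, evenKernel M θ s * χ s
    set J := ∫ s in (0:ℝ)..π, evenKernel M θ s * G s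
    have h' : |σ * (I - χ θ)| ≤ J := by rwa [abs_mul, hσabs, one_mul]
    have := neg_le_of_abs_le h'
    linear_combination this - J * hσσ
  refine ⟨f, hone, fun m hm => (abs_coeff_sub_le ha hab hb hm f).trans ?_⟩
  have hbound : ∫ θ in (0:ℝ)..π,
      |(∑ n ∈ range (M + 1), f n * (Chebyshev.U ℝ n).eval (cos θ)) - χ θ| =
      ∫ s in (0:ℝ)..π, G s := by
    have h1 : ∫ θ in (0:ℝ)..π,
        |(∑ n ∈ range (M + 1), f n * (Chebyshev.U ℝ n).eval (cos θ)) - χ θ| =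
        ∫ θ in (0:ℝ)..π,
          σ * ((∑ n ∈ range (M + 1), f n * (Chebyshev.U ℝ n).eval (cos θ)) - χ θ) := by
      refine intervalIntegral.integral_congr fun θ hθ => ?_
      rw [Set.uIcc_of_le pi_pos.le] at hθ
      have := abs_of_nonneg (hone θ hθ)
      rwa [abs_mul, hσabs, one_mul] at this
    rw [h1, intervalIntegral.integral_const_mul, intervalIntegral.integral_sub
      (Continuous.intervalIntegrable (by fun_prop) _ _) hχi]
    simp_rw [hF]
    rw [integral_integral_evenKernel_mul M hhi, intervalIntegral.integral_add hχi hσGi,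
      intervalIntegral.integral_const_mul, add_sub_cancel_left, ← mul_assoc, hσσ, one_mul]
  rw [hbound, hG, intervalIntegral.integral_add (Continuous.intervalIntegrable (by fun_prop) _ _)
    (Continuous.intervalIntegrable (by fun_prop) _ _), intervalIntegral.integral_const_mul,
    intervalIntegral.integral_const_mul]
  have hIa := integral_cosBump_le hδ0 hω0 hδω ⟨ha, hab.trans hb⟩
  have hIb := integral_cosBump_le hδ0 hω0 hδω ⟨ha.trans hab, hb⟩
  calc 2 / π * (6 * (∫ s in (0:ℝ)..π, cosBump δ a s) + 6 * ∫ s in (0:ℝ)..π, cosBump δ b s)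
      ≤ 2 / π * (12 * (π ^ 2 / 2 * ω)) := mul_le_mul_of_nonneg_left (by linarith) (by positivity)
    _ = 12 * π ^ 2 / (M + 2) := by
        rw [hω]
        field_simp
    _ ≤ 12 * π ^ 2 / (M + 1) := by gcongr; norm_num

/-- Beurling–Selberg majorants/minorants in the Chebyshev basis: there is a constant
`C > 0` such that for every interval `I = [a,b] ⊆ [0,π]` and every positive integer
`M`, there exist coefficients `f_0^±, …, f_M^±` with
(i) `∑_{m=0}^M f_m^− U_m(cos θ) ≤ χ_I(θ) ≤ ∑_{m=0}^M f_m^+ U_m(cos θ)` for all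
`θ ∈ [0,π]`, and
(ii) `|f_m^± − ĉ_m(I)| ≤ C/(M+1)` for all `0 ≤ m ≤ M`, where
`ĉ_m(I) = (2/π)∫_a^b U_m(cos θ) sin²θ dθ`. -/
theorem beurling_selberg_chebyshev :
    ∃ C : ℝ, 0 < C ∧ ∀ a b : ℝ, 0 ≤ a → a ≤ b → b ≤ π → ∀ M : ℕ, 0 < M →
      ∃ fplus fminus : ℕ → ℝ,
        (∀ θ ∈ Set.Icc (0:ℝ) π,
          (∑ m ∈ Finset.range (M + 1),
              fminus m * (Polynomial.Chebyshev.U ℝ m).eval (Real.cos θ)) ≤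
            Set.indicator (Set.Icc a b) (fun _ => (1:ℝ)) θ ∧
          Set.indicator (Set.Icc a b) (fun _ => (1:ℝ)) θ ≤
            ∑ m ∈ Finset.range (M + 1),
              fplus m * (Polynomial.Chebyshev.U ℝ m).eval (Real.cos θ)) ∧
        (∀ m : ℕ, m ≤ M →
          |fplus m - (2 / π) * ∫ θ in a..b,
              (Polynomial.Chebyshev.U ℝ m).eval (Real.cos θ) * Real.sin θ ^ 2|
            ≤ C / (M + 1) ∧
          |fminus m - (2 / π) * ∫ θ in a..b,
              (Polynomial.Chebyshev.U ℝ m).eval (Real.cos θ) * Real.sin θ ^ 2|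
            ≤ C / (M + 1)) := by
  refine ⟨12 * π ^ 2, by positivity, fun a b ha hab hb M _ => ?_⟩
  obtain ⟨f, hf, hf'⟩ := exists_one_sided_approximation ha hab hb M (Or.inl rfl)
  obtain ⟨g, hg, hg'⟩ := exists_one_sided_approximation ha hab hb M (Or.inr rfl)
  refine ⟨f, g, fun θ hθ => ⟨?_, ?_⟩, fun m hm => ⟨hf' m hm, hg' m hm⟩⟩
  · linarith [hg θ hθ]
  · linarith [hf θ hθ]
end
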